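/- arXiv:1305.4071 — 4 statements merged into one kernel-verified Lean document; each statement's English description precedes it below -/
import Mathlib

section
/- Let V be a real normed vector space of finite dimension s with 0 < s < ∞, let n be a natural number with n < s, and let N : V → ℝⁿ be a continuous map. Then for every real r ≥ 0 there exists an element f* ∈ V with ‖f*‖ = r such that N(f*) = N(−f*). -/
/-- Augmented ordered simplicial chains with mod 2 coefficients; the list `[x₀, …, xₖ]` stands for
an ordered `k`-simplex. -/
abbrev ListChain (E : Type*) := List E →₀ ZMod 2

namespace ListChain

open Finsupp

variable {E F : Type*}

/-- The chain of a single simplex. -/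
noncomputable abbrev simplex (l : List E) : ListChain E := single l 1

theorem hom_ext {M : Type*} [AddCommMonoid M] [Module (ZMod 2) M]
    {φ ψ : ListChain E →ₗ[ZMod 2] M} (h : ∀ l, φ (simplex l) = ψ (simplex l)) : φ = ψ :=
  Finsupp.lhom_ext' fun l => LinearMap.ext_ring (h l)

theorem add_self (c : ListChain E) : c + c = 0 := by
  ext l
  exact CharTwo.add_self_eq_zero (c l)

/-- The pushforward of chains along a map of vertices. -/
noncomputable def push (f : E → F) : ListChain E →ₗ[ZMod 2] ListChain F :=
  lmapDomain (ZMod 2) (ZMod 2) (List.map f)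

/-- The cone with apex `x`. -/
noncomputable def cone (x : E) : ListChain E →ₗ[ZMod 2] ListChain E :=
  lmapDomain (ZMod 2) (ZMod 2) (List.cons x)

@[simp] theorem push_simplex (f : E → F) (l : List E) :
    push f (simplex l) = simplex (l.map f) := by
  simp [push, lmapDomain_apply, mapDomain_single]

@[simp] theorem cone_simplex (x : E) (l : List E) :
    cone x (simplex l) = simplex (x :: l) := by
  simp [cone, lmapDomain_apply, mapDomain_single]

theorem push_cone (f : E → F) (x : E) (c : ListChain E) :
    push f (cone x c) = cone (f x) (push f c) := by
  have : push f ∘ₗ cone x = cone (f x) ∘ₗ push f := hom_ext fun l => by simp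
  exact LinearMap.congr_fun this c

theorem push_neg_push_neg [InvolutiveNeg E] (c : ListChain E) :
    push Neg.neg (push Neg.neg c) = c := by
  have : push (Neg.neg : E → E) ∘ₗ push Neg.neg = LinearMap.id := hom_ext fun l => by simp
  exact LinearMap.congr_fun this c

/-- The boundary of a single simplex. -/
noncomputable def listBoundary : List E → ListChain E
  | [] => 0
  | x :: l => simplex l + cone x (listBoundary l)

/-- The (augmented) simplicial boundary. -/
noncomputable def boundary : ListChain E →ₗ[ZMod 2] ListChain E :=
  linearCombination (ZMod 2) listBoundary

@[simp] theorem boundary_simplex (l : List E) : boundary (simplex l) = listBoundary l := by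
  simp [boundary]

theorem boundary_cone (x : E) (c : ListChain E) :
    boundary (cone x c) = c + cone x (boundary c) := by
  have : boundary ∘ₗ cone x = LinearMap.id + cone x ∘ₗ boundary :=
    hom_ext fun l => by simp [listBoundary]
  exact LinearMap.congr_fun this c

theorem boundary_boundary (c : ListChain E) : boundary (boundary c) = 0 := by
  have : boundary ∘ₗ boundary = (0 : ListChain E →ₗ[ZMod 2] ListChain E) := hom_ext fun l => by
    induction l with
    | nil => simp [listBoundary]
    | cons x l ih =>
      simp only [LinearMap.comp_apply, boundary_simplex, LinearMap.zero_apply] at ih ⊢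
      rw [listBoundary, map_add, boundary_simplex, boundary_cone, ih, map_zero, add_zero,
        add_self]
  exact LinearMap.congr_fun this c

theorem boundary_push (f : E → F) (c : ListChain E) :
    boundary (push f c) = push f (boundary c) := by
  have : boundary ∘ₗ push f = push f ∘ₗ boundary := hom_ext fun l => by
    induction l with
    | nil => simp [listBoundary]
    | cons x l ih =>
      simp only [LinearMap.comp_apply, boundary_simplex, push_simplex] at ih ⊢
      rw [List.map_cons, listBoundary, ih, listBoundary, map_add, push_simplex, push_cone]
  exact LinearMap.congr_fun this c

/-- The chains all of whose simplices satisfy `p`. -/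
noncomputable abbrev carried (p : List E → Prop) : Submodule (ZMod 2) (ListChain E) :=
  supported (ZMod 2) (ZMod 2) {l | p l}

theorem simplex_mem_carried {p : List E → Prop} {l : List E} (h : p l) :
    simplex l ∈ carried p :=
  single_mem_supported _ _ h

theorem map_mem_of_mem_carried {M : Type*} [AddCommMonoid M] [Module (ZMod 2) M]
    {p : List E → Prop} {W : Submodule (ZMod 2) M} {φ : ListChain E →ₗ[ZMod 2] M}
    (h : ∀ l, p l → φ (simplex l) ∈ W) {c : ListChain E} (hc : c ∈ carried p) : φ c ∈ W := by
  have : carried p ≤ W.comap φ := by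
    rw [carried, supported_eq_span_single, Submodule.span_le]
    rintro _ ⟨l, hl, rfl⟩
    exact h l hl
  exact this hc

theorem eq_of_mem_carried {M : Type*} [AddCommGroup M] [Module (ZMod 2) M]
    {p : List E → Prop} {φ ψ : ListChain E →ₗ[ZMod 2] M}
    (h : ∀ l, p l → φ (simplex l) = ψ (simplex l)) {c : ListChain E} (hc : c ∈ carried p) :
    φ c = ψ c := by
  have : (φ - ψ) c ∈ (⊥ : Submodule (ZMod 2) M) :=
    map_mem_of_mem_carried (p := p) (fun l hl => by simp [h l hl]) hc
  simpa [sub_eq_zero] using this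

theorem carried_mono {p q : List E → Prop} (h : ∀ l, p l → q l) {c : ListChain E}
    (hc : c ∈ carried p) : c ∈ carried q :=
  supported_mono (fun l hl => h l hl) hc

theorem cone_mem_carried {p q : List E → Prop} {x : E} (h : ∀ l, p l → q (x :: l))
    {c : ListChain E} (hc : c ∈ carried p) : cone x c ∈ carried q :=
  map_mem_of_mem_carried (fun l hl => by
    rw [cone_simplex]; exact simplex_mem_carried (h l hl)) hc

theorem listBoundary_mem_carried (l : List E) :
    listBoundary l ∈ carried fun t : List E => t.Sublist l ∧ t.length + 1 = l.length := by
  induction l with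
  | nil => exact zero_mem _
  | cons x l ih =>
    refine add_mem (simplex_mem_carried ⟨List.sublist_cons_self x l, rfl⟩)
      (cone_mem_carried (fun t ht => ⟨ht.1.cons_cons x, ?_⟩) ih)
    simpa using ht.2

/-! ### Products of sign cochains -/

/-- Multiplication of each simplex by the value of `s` at its first vertex. -/
noncomputable def weight (s : E → ZMod 2) : ListChain E →ₗ[ZMod 2] ListChain E :=
  linearCombination (ZMod 2) fun l => match l with
    | [] => 0
    | x :: l => s x • simplex (x :: l)

@[simp] theorem weight_nil (s : E → ZMod 2) : weight s (simplex []) = 0 := by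
  simp [weight]

@[simp] theorem weight_cons (s : E → ZMod 2) (x : E) (l : List E) :
    weight s (simplex (x :: l)) = s x • simplex (x :: l) := by
  simp [weight]

theorem weight_cone (s : E → ZMod 2) (x : E) (c : ListChain E) :
    weight s (cone x c) = s x • cone x c := by
  have : weight s ∘ₗ cone x = s x • cone x := hom_ext fun l => by
    rw [LinearMap.comp_apply, cone_simplex, weight_cons, LinearMap.smul_apply, cone_simplex]
  exact LinearMap.congr_fun this c

/-- The cup product of the coboundaries of `s (k - 1), …, s 0`. -/
noncomputable def cup (s : ℕ → E → ZMod 2) : ℕ → ListChain E →ₗ[ZMod 2] ZMod 2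
  | 0 => linearCombination (ZMod 2) fun l => if l.length = 1 then 1 else 0
  | k + 1 => cup s k ∘ₗ weight (s k) ∘ₗ boundary

theorem cup_zero_simplex (s : ℕ → E → ZMod 2) (l : List E) :
    cup s 0 (simplex l) = if l.length = 1 then 1 else 0 := by
  simp [cup]

theorem cup_boundary (s : ℕ → E → ZMod 2) (k : ℕ) (c : ListChain E) :
    cup s k (boundary c) = 0 := by
  cases k with
  | succ k => simp [cup, boundary_boundary]
  | zero =>
    have : cup s 0 ∘ₗ boundary = 0 := hom_ext fun l => by
      match l with
      | [] => simp [listBoundary]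
      | [x] => simp [listBoundary, cup_zero_simplex]
      | [x, y] =>
        simp only [LinearMap.comp_apply, boundary_simplex, listBoundary, map_add, map_zero,
          cone_simplex, cup_zero_simplex, LinearMap.zero_apply, List.length_singleton, if_true,
          add_zero]
        exact CharTwo.add_self_eq_zero 1
      | x :: y :: z :: l =>
        have key : cup s 0 (listBoundary (x :: y :: z :: l)) ∈ (⊥ : Submodule (ZMod 2) (ZMod 2)) :=
          map_mem_of_mem_carried (fun t ht => by
            have := ht.2
            simp only [List.length_cons] at this
            rw [cup_zero_simplex, if_neg (by omega)]
            exact zero_mem _) (listBoundary_mem_carried _)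
        simpa using key
    exact LinearMap.congr_fun this c

theorem cup_nil (s : ℕ → E → ZMod 2) (k : ℕ) : cup s k (simplex []) = 0 := by
  cases k with
  | zero => simp [cup_zero_simplex]
  | succ k => simp [cup, listBoundary]

theorem cup_succ_singleton (s : ℕ → E → ZMod 2) (k : ℕ) (x : E) :
    cup s (k + 1) (simplex [x]) = 0 := by
  simp [cup, listBoundary]

theorem cup_succ_cons_cons (s : ℕ → E → ZMod 2) (k : ℕ) (x y : E) (l : List E) :
    cup s (k + 1) (simplex (x :: y :: l)) = (s k x + s k y) * cup s k (simplex (y :: l)) := by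
  have h := cup_boundary s k (cone x (simplex (y :: l)))
  rw [boundary_cone, map_add, CharTwo.add_eq_zero] at h
  rw [← cone_simplex, cup, LinearMap.comp_apply, LinearMap.comp_apply, boundary_cone, map_add,
    map_add, weight_cone, map_smul, ← h, weight_cons, map_smul, smul_eq_mul, smul_eq_mul]
  ring

theorem cup_eq_zero_of_constant (s : ℕ → E → ZMod 2) {i k : ℕ} (hi : i < k) (l : List E)
    (hl : ∀ x ∈ l, ∀ y ∈ l, s i x = s i y) : cup s k (simplex l) = 0 := by
  induction k generalizing l with
  | zero => omega
  | succ k ih =>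
    match l with
    | [] => exact cup_nil s _
    | [x] => exact cup_succ_singleton s k x
    | x :: y :: l =>
      rw [cup_succ_cons_cons]
      rcases Nat.lt_succ_iff_lt_or_eq.1 hi with h | rfl
      · rw [ih h (y :: l) fun a ha b hb =>
          hl a (List.mem_cons_of_mem _ ha) b (List.mem_cons_of_mem _ hb), mul_zero]
      · rw [hl x (by simp) y (by simp), CharTwo.add_self_eq_zero, zero_mul]

section Antipodal

variable [AddCommGroup E]

theorem cup_map_neg {s : ℕ → E → ZMod 2} (hs : ∀ i x, x ≠ 0 → s i (-x) = s i x + 1)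
    (k : ℕ) (l : List E) (hl : ∀ x ∈ l, x ≠ 0) :
    cup s k (simplex (l.map Neg.neg)) = cup s k (simplex l) := by
  induction k generalizing l with
  | zero => simp [cup_zero_simplex]
  | succ k ih =>
    match l with
    | [] => rfl
    | [x] => simp only [List.map_cons, List.map_nil, cup_succ_singleton]
    | x :: y :: l =>
      have ih' := ih (y :: l) fun a ha => hl a (List.mem_cons_of_mem _ ha)
      rw [List.map_cons] at ih'
      rw [List.map_cons, List.map_cons, cup_succ_cons_cons, cup_succ_cons_cons, ih',
        hs k x (hl x (by simp)), hs k y (hl y (by simp))]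
      linear_combination cup s k (simplex (y :: l)) * CharTwo.add_self_eq_zero (1 : ZMod 2)

theorem cup_succ_of_boundary {s : ℕ → E → ZMod 2} (hs : ∀ i x, x ≠ 0 → s i (-x) = s i x + 1)
    {k : ℕ} {c d : ListChain E} (hc : c ∈ carried fun l : List E => ∀ x ∈ l, x ≠ 0)
    (hd : boundary d = c + push Neg.neg c) : cup s (k + 1) d = cup s k c := by
  have : cup s (k + 1) d = (cup s k ∘ₗ weight (s k) ∘ₗ (LinearMap.id + push Neg.neg)) c := by
    simp [cup, hd]
  rw [this]
  refine eq_of_mem_carried (fun l hl => ?_) hc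
  match l with
  | [] => simp [cup_nil]
  | x :: l =>
    have h := cup_map_neg hs k (x :: l) hl
    simp only [LinearMap.comp_apply, LinearMap.add_apply, LinearMap.id_apply, push_simplex,
      List.map_cons, map_add, weight_cons, map_smul, smul_eq_mul] at h ⊢
    rw [h, hs k x (hl x (by simp))]
    linear_combination s k x * cup s k (simplex (x :: l)) *
      CharTwo.add_self_eq_zero (1 : ZMod 2)

/-- The iterated suspension `[v₀]`, `vₖ₊₁ * (cₖ + -cₖ)`: a fundamental chain of a hemisphere of the
cross-polytope with vertices `±vᵢ`. -/
noncomputable def hemisphere (v : ℕ → E) : ℕ → ListChain E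
  | 0 => simplex [v 0]
  | k + 1 => cone (v (k + 1)) (hemisphere v k + push Neg.neg (hemisphere v k))

theorem boundary_hemisphere (v : ℕ → E) (k : ℕ) :
    boundary (hemisphere v (k + 1)) = hemisphere v k + push Neg.neg (hemisphere v k) := by
  suffices h : boundary (hemisphere v k + push Neg.neg (hemisphere v k)) = 0 by
    rw [hemisphere, boundary_cone, h, map_zero, add_zero]
  induction k with
  | zero => simp [hemisphere, listBoundary, add_self]
  | succ k ih =>
    rw [map_add, boundary_push, hemisphere, boundary_cone, ih, map_zero, add_zero, map_add,
      push_neg_push_neg, add_comm (push Neg.neg _), add_self]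

theorem hemisphere_mem_carried [Module ℝ E] (v : ℕ → E) (k : ℕ) :
    hemisphere v k ∈ carried fun l : List E => l.length = k + 1 ∧
      ∃ ε : ℕ → ℝ, (∀ i, ε i = 1 ∨ ε i = -1) ∧ ∀ x ∈ l, ∃ i ≤ k, x = ε i • v i := by
  induction k with
  | zero =>
    exact simplex_mem_carried ⟨rfl, fun _ => 1, fun _ => Or.inl rfl,
      fun x hx => ⟨0, by simpa using hx⟩⟩
  | succ k ih =>
    refine cone_mem_carried ?_ (add_mem ih (map_mem_of_mem_carried (fun l hl => ?_) ih))
    · rintro l ⟨hl, ε, hε, h⟩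
      refine ⟨by simpa using hl, Function.update ε (k + 1) 1, fun i => ?_, fun x hx => ?_⟩
      · rcases eq_or_ne i (k + 1) with rfl | hi
        · simp
        · simpa [hi] using hε i
      · rcases List.mem_cons.1 hx with rfl | hx
        · exact ⟨k + 1, le_rfl, by simp⟩
        · obtain ⟨i, hi, rfl⟩ := h x hx
          exact ⟨i, hi.trans k.le_succ, by rw [Function.update_of_ne (by omega)]⟩
    · obtain ⟨hl, ε, hε, h⟩ := hl
      rw [push_simplex]
      refine simplex_mem_carried ⟨by simpa using hl, -ε, fun i => ?_, fun x hx => ?_⟩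
      · rcases hε i with h | h <;> simp [h]
      · obtain ⟨y, hy, rfl⟩ := List.mem_map.1 hx
        obtain ⟨i, hi, rfl⟩ := h y hy
        exact ⟨i, hi, by simp⟩

end Antipodal

/-! ### Barycentric subdivision -/

section Subdivision

variable [NormedAddCommGroup E] [NormedSpace ℝ E]

/-- The barycenter of a list of points. -/
noncomputable def barycenter (l : List E) : E := (l.length : ℝ)⁻¹ • l.sum

/-- Barycentric subdivision of simplices with `k` vertices. -/
noncomputable def subdivide : ℕ → ListChain E →ₗ[ZMod 2] ListChain E
  | 0 => LinearMap.id
  | k + 1 => linearCombination (ZMod 2) fun l =>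
      cone (barycenter l) (subdivide k (listBoundary l))

theorem subdivide_succ_simplex (k : ℕ) (l : List E) :
    subdivide (k + 1) (simplex l) = cone (barycenter l) (subdivide k (listBoundary l)) := by
  simp [subdivide]

theorem boundary_subdivide (k : ℕ) (c : ListChain E) :
    boundary (subdivide (k + 1) c) = subdivide k (boundary c) := by
  have : boundary ∘ₗ subdivide (k + 1) = (subdivide k ∘ₗ boundary : ListChain E →ₗ[ZMod 2] _) := by
    induction k with
    | zero =>
      refine hom_ext fun l => ?_
      rw [LinearMap.comp_apply, subdivide_succ_simplex, subdivide, LinearMap.id_apply,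
        boundary_cone, ← boundary_simplex, boundary_boundary, map_zero, add_zero]
      rfl
    | succ k ih =>
      refine hom_ext fun l => ?_
      have h := LinearMap.congr_fun ih (boundary (simplex l))
      simp only [LinearMap.comp_apply, boundary_boundary, map_zero] at h ⊢
      rw [subdivide_succ_simplex, boundary_cone, ← boundary_simplex, h, map_zero, add_zero]
  exact LinearMap.congr_fun this c

theorem barycenter_map_neg (l : List E) : barycenter (l.map Neg.neg) = -barycenter l := by
  have : (l.map Neg.neg).sum = -l.sum := by
    induction l with
    | nil => simp
    | cons x l ih => simp only [List.map_cons, List.sum_cons, ih, neg_add]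
  simp [barycenter, this]

theorem subdivide_push_neg (k : ℕ) (c : ListChain E) :
    subdivide k (push Neg.neg c) = push Neg.neg (subdivide k c) := by
  induction k generalizing c with
  | zero => rfl
  | succ k ih =>
    have : subdivide (k + 1) ∘ₗ push Neg.neg =
        (push Neg.neg ∘ₗ subdivide (k + 1) : ListChain E →ₗ[ZMod 2] _) := hom_ext fun l => by
      simp only [LinearMap.comp_apply, push_simplex, subdivide_succ_simplex]
      rw [← boundary_simplex, ← push_simplex, boundary_push, ih, barycenter_map_neg, push_cone,
        boundary_simplex]
    exact LinearMap.congr_fun this c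

theorem subdivide_one_singleton (x : E) : subdivide 1 (simplex [x]) = simplex [x] := by
  rw [subdivide_succ_simplex]
  simp [listBoundary, subdivide, barycenter]

theorem barycenter_mem {A : Set E} (hA : Convex ℝ A) {l : List E} (hne : l ≠ [])
    (hl : ∀ x ∈ l, x ∈ A) : barycenter l ∈ A := by
  have h := hA.sum_mem (t := Finset.univ) (w := fun _ : Fin l.length => (l.length : ℝ)⁻¹)
    (z := l.get) (fun _ _ => by positivity)
    (by simp [mul_inv_cancel₀ (show (l.length : ℝ) ≠ 0 by simpa using hne)])
    (fun i _ => hl _ (List.get_mem l i))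
  rw [← Finset.smul_sum] at h
  rw [barycenter]
  convert h using 2
  simp [← List.sum_ofFn]

theorem subdivide_mem_carried_of_convex {A : Set E} (hA : Convex ℝ A) (k : ℕ) {c : ListChain E}
    (hc : c ∈ carried fun l : List E => ∀ x ∈ l, x ∈ A) :
    subdivide k c ∈ carried fun l : List E => ∀ x ∈ l, x ∈ A := by
  induction k generalizing c with
  | zero => exact hc
  | succ k ih =>
    refine map_mem_of_mem_carried (fun l hl => ?_) hc
    rw [subdivide_succ_simplex]
    rcases eq_or_ne l [] with rfl | hne
    · simp [listBoundary]
    · refine cone_mem_carried (fun t ht => ?_) (ih (carried_mono (fun t ht x hx => ?_)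
        (listBoundary_mem_carried l)))
      · exact List.forall_mem_cons.2 ⟨barycenter_mem hA hne hl, ht⟩
      · exact hl x (ht.1.subset hx)

theorem dist_barycenter_le {D : ℝ} {l : List E} (hl : ∀ x ∈ l, ∀ y ∈ l, dist x y ≤ D)
    {n : ℕ} (hn : l.length ≤ n + 1) {x : E} (hx : x ∈ l) :
    dist x (barycenter l) ≤ n / (n + 1) * D := by
  obtain ⟨a, b, rfl⟩ := List.append_of_mem hx
  have hD : 0 ≤ D := dist_nonneg.trans (hl x hx x hx)
  have key : ∀ t : List E, (∀ y ∈ t, dist x y ≤ D) →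
      ‖(t.length : ℝ) • x - t.sum‖ ≤ t.length * D := by
    intro t ht
    induction t with
    | nil => simp
    | cons y t ih =>
      have h1 := ih fun z hz => ht z (List.mem_cons_of_mem _ hz)
      have h2 := ht y (by simp)
      rw [dist_eq_norm] at h2
      have : ((y :: t).length : ℝ) • x - (y :: t).sum = (x - y) + ((t.length : ℝ) • x - t.sum) := by
        simp only [List.length_cons, List.sum_cons, Nat.cast_add, Nat.cast_one, add_smul, one_smul]
        abel
      rw [this]
      refine (norm_add_le _ _).trans ?_
      simp only [List.length_cons, Nat.cast_add, Nat.cast_one]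
      linarith
  have h := key (a ++ b) fun y hy => hl x hx y (by
    rcases List.mem_append.1 hy with h | h <;> simp [h])
  set m : ℝ := ((a ++ b).length : ℝ) with hm
  have hlen : ((a ++ x :: b).length : ℝ) = m + 1 := by
    rw [hm]; push_cast [List.length_append, List.length_cons]; ring
  have hm0 : 0 ≤ m := by positivity
  have hmn : m ≤ n := by
    have : ((a ++ x :: b).length : ℝ) ≤ n + 1 := by exact_mod_cast hn
    linarith
  have hsum : x - barycenter (a ++ x :: b) = (m + 1)⁻¹ • (m • x - (a ++ b).sum) := by
    rw [barycenter, hlen, eq_inv_smul_iff₀ (by positivity), smul_sub,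
      smul_inv_smul₀ (by positivity)]
    simp only [List.sum_append, List.sum_cons, add_smul, one_smul]
    abel
  rw [dist_eq_norm, hsum, norm_smul, norm_inv, Real.norm_of_nonneg (by positivity)]
  calc (m + 1)⁻¹ * ‖m • x - (a ++ b).sum‖ ≤ (m + 1)⁻¹ * (m * D) := by gcongr
    _ = m / (m + 1) * D := by ring
    _ ≤ n / (n + 1) * D := by
      refine mul_le_mul_of_nonneg_right ?_ hD
      rw [div_le_div_iff₀ (by positivity) (by positivity)]
      linarith

theorem subdivide_mem_carried_of_dist_le {D : ℝ} (hD : 0 ≤ D) {n k : ℕ} (hk : k ≤ n + 1)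
    {c : ListChain E}
    (hc : c ∈ carried fun l : List E => l.length ≤ k ∧ ∀ x ∈ l, ∀ y ∈ l, dist x y ≤ D) :
    subdivide k c ∈ carried fun l : List E =>
      l.length ≤ k ∧ ∀ x ∈ l, ∀ y ∈ l, dist x y ≤ n / (n + 1) * D := by
  induction k generalizing c with
  | zero =>
    refine map_mem_of_mem_carried (fun l hl => simplex_mem_carried ⟨hl.1, ?_⟩) hc
    simp [List.length_eq_zero_iff.1 (Nat.le_zero.1 hl.1)]
  | succ k ih =>
    refine map_mem_of_mem_carried (fun l hl => ?_) hc
    rw [subdivide_succ_simplex]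
    have hD' : 0 ≤ n / (n + 1) * D := by positivity
    have h1 := ih (by omega) (carried_mono (fun t ht => ⟨by have := ht.2; have := hl.1; omega,
      fun x hx y hy => hl.2 x (ht.1.subset hx) y (ht.1.subset hy)⟩) (listBoundary_mem_carried l))
    have hball : ∀ x ∈ l, x ∈ Metric.closedBall (barycenter l) (n / (n + 1) * D) :=
      fun x hx => dist_barycenter_le hl.2 (hl.1.trans hk) hx
    have h2 := subdivide_mem_carried_of_convex (convex_closedBall _ _) k
      (carried_mono (fun t ht x hx => hball x (ht.1.subset hx)) (listBoundary_mem_carried l))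
    have h3 := Submodule.mem_inf.2 ⟨h1, h2⟩
    rw [carried, carried, ← supported_inter] at h3
    refine cone_mem_carried (fun t ht => ⟨?_, ?_⟩) h3
    · simpa using ht.1.1
    · simp only [List.forall_mem_cons, dist_self]
      exact ⟨⟨hD', fun y hy => dist_comm y _ ▸ ht.2 y hy⟩,
        fun x hx => ⟨ht.2 x hx, fun y hy => ht.1.2 x hx y hy⟩⟩

/-- Iterated subdivision makes a tower of hemispheres arbitrarily fine, without leaving the
convex sets that carry it. -/
theorem exists_fine_hemispheres (K : Set E) (n : ℕ) {D : ℝ} (hD : 0 ≤ D) (v : ℕ → E)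
    (hdist : ∀ x ∈ K, ∀ y ∈ K, dist x y ≤ D)
    (hK : ∀ k ≤ n, hemisphere v k ∈ carried fun l : List E =>
      l.length ≤ k + 1 ∧ ∃ A, Convex ℝ A ∧ A ⊆ K ∧ ∀ x ∈ l, x ∈ A) (N : ℕ) :
    ∃ h : ℕ → ListChain E, h 0 = simplex [v 0] ∧
      (∀ k, boundary (h (k + 1)) = h k + push Neg.neg (h k)) ∧
      (∀ k ≤ n, h k ∈ carried fun l : List E =>
        l.length ≤ k + 1 ∧ ∀ x ∈ l, ∀ y ∈ l, dist x y ≤ (n / (n + 1)) ^ N * D) ∧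
      ∀ k ≤ n, h k ∈ carried fun l : List E =>
        ∃ A, Convex ℝ A ∧ A ⊆ K ∧ ∀ x ∈ l, x ∈ A := by
  induction N with
  | zero =>
    refine ⟨hemisphere v, rfl, boundary_hemisphere v, fun k hk => ?_, fun k hk => ?_⟩
    · refine carried_mono ?_ (hK k hk)
      rintro l ⟨hl, A, -, hA, hlA⟩
      exact ⟨hl, fun x hx y hy => by
        simpa using hdist x (hA (hlA x hx)) y (hA (hlA y hy))⟩
    · exact carried_mono (fun l hl => hl.2) (hK k hk)
  | succ N ih =>
    obtain ⟨h, h0, hb, hd, hA⟩ := ih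
    refine ⟨fun k => subdivide (k + 1) (h k), ?_, fun k => ?_, fun k hk => ?_, fun k hk => ?_⟩
    · simp only [h0, zero_add, subdivide_one_singleton]
    · rw [boundary_subdivide, hb, map_add, subdivide_push_neg]
    · rw [pow_succ', mul_assoc]
      exact subdivide_mem_carried_of_dist_le (by positivity) (by omega) (hd k hk)
    · refine map_mem_of_mem_carried (fun l hl => ?_) (hA k hk)
      obtain ⟨A, hc, hAK, hlA⟩ := hl
      exact carried_mono (fun t ht => ⟨A, hc, hAK, ht⟩)
        (subdivide_mem_carried_of_convex hc (k + 1) (simplex_mem_carried hlA))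

end Subdivision

end ListChain

/-- An odd function has an odd choice of sign, even at its zeros. -/
theorem exists_odd_sign {E : Type*} [AddCommGroup E] [Module ℝ E] (φ : E → ℝ)
    (hφ : ∀ x, φ (-x) = -φ x) :
    ∃ σ : E → ZMod 2, (∀ x, x ≠ 0 → σ (-x) = σ x + 1) ∧ (∀ x, 0 < φ x → σ x = 1) ∧
      ∀ x, φ x < 0 → σ x = 0 := by
  classical
  refine ⟨fun x => if 0 < φ x ∨ (φ x = 0 ∧ WellOrderingRel x (-x)) then 1 else 0,
    fun x hx => ?_, fun x hx => by simp [hx], fun x hx => by simp [hx.not_gt, hx.ne]⟩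
  have hne : x ≠ -x := fun h => hx (by
    have h2 : (2 : ℝ) • x = 0 := by rw [two_smul, add_eq_zero_iff_eq_neg]; exact h
    simpa using h2)
  have h11 : (1 : ZMod 2) + 1 = 0 := CharTwo.add_self_eq_zero 1
  rcases lt_trichotomy (φ x) 0 with h | h | h
  · simp [hφ, h, h.not_gt, h.ne]
  · rcases trichotomous_of WellOrderingRel x (-x) with hr | hr | hr
    · simp [hφ, h, hr, asymm_of WellOrderingRel hr, h11]
    · exact absurd hr hne
    · simp [hφ, h, hr, asymm_of WellOrderingRel hr]
  · simp [hφ, h, h.not_gt, h.ne', h11]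

open ListChain in
/-- **Borsuk–Ulam theorem** for odd maps on a punctured Euclidean space. -/
theorem exists_eq_zero_of_odd {s n : ℕ} (hn : n < s) (g : (Fin s → ℝ) → Fin n → ℝ)
    (hg : ContinuousOn g {0}ᶜ) (hodd : ∀ x, g (-x) = -g x) : ∃ x, x ≠ 0 ∧ g x = 0 := by
  by_contra! hne
  let G : ℕ → (Fin s → ℝ) → ℝ := fun i x => if h : i < n then g x ⟨i, h⟩ else 0
  have hG : ∀ i x, G i (-x) = -G i x := fun i x => by
    by_cases h : i < n <;> simp [G, h, hodd]
  choose σ hσ hσ1 hσ0 using fun i => exists_odd_sign (G i) (hG i)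
  set K : Set (Fin s → ℝ) := {x | ∑ i, |x i| = 1} with hKdef
  have hK0 : ∀ x ∈ K, x ≠ 0 := by
    rintro _ hx rfl
    simp [hKdef] at hx
  have hKc : IsCompact K := by
    refine Metric.isCompact_of_isClosed_isBounded (isClosed_eq (by fun_prop) (by fun_prop))
      (Metric.isBounded_closedBall (x := 0) (r := 1) |>.subset fun x hx => ?_)
    rw [mem_closedBall_zero_iff, pi_norm_le_iff_of_nonneg zero_le_one]
    intro i
    have hx : ∑ i, |x i| = 1 := hx
    rw [← hx]
    exact Finset.single_le_sum (f := fun i => |x i|) (fun _ _ => abs_nonneg _) (Finset.mem_univ i)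
  obtain ⟨η, hη, hball⟩ := lebesgue_number_lemma_of_metric
    (c := fun p : Fin n × ZMod 2 => interior {x | σ p.1 x = p.2}) hKc
    (fun _ => isOpen_interior) (fun x hx => by
      have hx0 := hK0 x hx
      obtain ⟨i, hi⟩ : ∃ i, g x i ≠ 0 := by
        by_contra! h
        exact hne x hx0 (funext h)
      have hcont : ContinuousAt (fun y => g y i) x :=
        (continuous_apply i).continuousAt.comp
          (hg.continuousAt (isOpen_compl_singleton.mem_nhds hx0))
      rw [Set.mem_iUnion]
      rcases hi.lt_or_gt with h | h
      · refine ⟨(i, 0), mem_interior_iff_mem_nhds.2 ?_⟩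
        filter_upwards [hcont.eventually_lt continuousAt_const h] with y hy
        exact hσ0 i y (by simpa [G] using hy)
      · refine ⟨(i, 1), mem_interior_iff_mem_nhds.2 ?_⟩
        filter_upwards [continuousAt_const.eventually_lt hcont h] with y hy
        exact hσ1 i y (by simpa [G] using hy))
  obtain ⟨C, hC⟩ := Metric.isBounded_iff.1 hKc.isBounded
  set v : ℕ → Fin s → ℝ := fun i => if h : i < s then Pi.single ⟨i, h⟩ 1 else 0 with hv
  have hKv : ∀ k ≤ n, hemisphere v k ∈ carried fun l : List (Fin s → ℝ) =>
      l.length ≤ k + 1 ∧ ∃ A, Convex ℝ A ∧ A ⊆ K ∧ ∀ x ∈ l, x ∈ A := by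
    intro k hk
    refine carried_mono ?_ (hemisphere_mem_carried v k)
    rintro l ⟨hl, ε, hε, hlε⟩
    have hε2 : ∀ i, ε i * ε i = 1 := fun i => by rcases hε i with h | h <;> simp [h]
    refine ⟨hl.le, {x | ∑ i : Fin s, ε i * x i = 1 ∧ ∀ i : Fin s, 0 ≤ ε i * x i}, ?_, ?_, ?_⟩
    · rintro x ⟨hx, hx'⟩ y ⟨hy, hy'⟩ a b ha hb hab
      have hlin : ∀ i : Fin s,
          ε i * (a • x + b • y) i = a * (ε i * x i) + b * (ε i * y i) := fun i => by
        simp only [Pi.add_apply, Pi.smul_apply, smul_eq_mul]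
        ring
      refine ⟨?_, fun i => ?_⟩
      · simp only [hlin, Finset.sum_add_distrib, ← Finset.mul_sum, hx, hy, mul_one, hab]
      · rw [hlin]
        have := hx' i
        have := hy' i
        positivity
    · rintro x ⟨hx, hx'⟩
      rw [hKdef, Set.mem_ofPred_eq, ← hx]
      refine Finset.sum_congr rfl fun i _ => ?_
      rw [← abs_of_nonneg (hx' i), abs_mul]
      rcases hε i with h | h <;> simp [h]
    · intro x hx
      obtain ⟨i, hi, rfl⟩ := hlε x hx
      have his : i < s := by omega
      have hval : ∀ j : Fin s, ε j * (ε i • v i) j = if j = ⟨i, his⟩ then 1 else 0 := fun j => by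
        rcases eq_or_ne j ⟨i, his⟩ with rfl | hj
        · simp [hv, his, hε2]
        · simp [hv, his, hj]
      refine ⟨by simp only [hval, Finset.sum_ite_eq', Finset.mem_univ, if_true], fun j => ?_⟩
      rw [hval]
      split_ifs <;> norm_num
  have hq : (n : ℝ) / (n + 1) < 1 := by rw [div_lt_one (by positivity)]; linarith
  obtain ⟨N, hN⟩ := ((tendsto_pow_atTop_nhds_zero_of_lt_one (by positivity) hq).mul_const
    (max C 0)).eventually_lt_const (by simpa using hη) |>.exists
  obtain ⟨h, h0, hb, hd, hA⟩ := exists_fine_hemispheres K n (le_max_right C 0) v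
    (fun x hx y hy => (hC hx hy).trans (le_max_left C 0)) hKv N
  have hcup : ∀ k ≤ n, cup σ k (h k) = 1 := by
    intro k hk
    induction k with
    | zero => simp [h0, cup_zero_simplex]
    | succ k ih =>
      rw [cup_succ_of_boundary hσ (carried_mono ?_ (hA k (by omega))) (hb k), ih (by omega)]
      rintro l ⟨A, -, hAK, hlA⟩ x hx
      exact hK0 x (hAK (hlA x hx))
  have hmem := Submodule.mem_inf.2 ⟨hd n le_rfl, hA n le_rfl⟩
  rw [carried, carried, ← Finsupp.supported_inter] at hmem
  have hzero : cup σ n (h n) = (0 : ListChain (Fin s → ℝ) →ₗ[ZMod 2] ZMod 2) (h n) := by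
    refine eq_of_mem_carried (fun l hl => ?_) hmem
    obtain ⟨⟨-, hl⟩, A, -, hAK, hlA⟩ := hl
    match l with
    | [] => exact cup_nil σ n
    | x :: l =>
      obtain ⟨⟨i, b⟩, hi⟩ := hball x (hAK (hlA x (by simp)))
      have hconst : ∀ y ∈ x :: l, σ i y = b := fun y hy => interior_subset (s := {x | σ i x = b})
        (hi (Metric.mem_ball.2 ((hl y hy x (by simp)).trans_lt hN)))
      exact cup_eq_zero_of_constant σ i.2 _ fun y hy z hz => by rw [hconst y hy, hconst z hz]
  rw [hcup n le_rfl] at hzero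
  exact one_ne_zero hzero

/-- **Borsuk–Ulam for normed spaces** (paper Lemma 2.1):
If `V` is a real normed space of finite dimension `s` with `0 < s`, `n < s`, and
`N : V → ℝⁿ` is continuous, then for every `r ≥ 0` there is `f⋆ ∈ V` with
`‖f⋆‖ = r` and `N f⋆ = N (-f⋆)`. -/
theorem stmt0 {V : Type*} [NormedAddCommGroup V] [NormedSpace ℝ V]
    [FiniteDimensional ℝ V] (s : ℕ) (hs : 0 < s)
    (hdim : Module.finrank ℝ V = s)
    (n : ℕ) (hn : n < s) (N : V → (Fin n → ℝ)) (hN : Continuous N)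
    (r : ℝ) (hr : 0 ≤ r) :
    ∃ f : V, ‖f‖ = r ∧ N f = N (-f) := by
  let T : (Fin s → ℝ) ≃L[ℝ] V := ContinuousLinearEquiv.ofFinrankEq (by simp [hdim])
  let P : (Fin s → ℝ) → V := fun x => (r / ‖T x‖) • T x
  have hP : ContinuousOn P {0}ᶜ := by
    refine ContinuousOn.smul (continuousOn_const.div (by fun_prop) fun x hx => ?_) (by fun_prop)
    simpa using hx
  have hPneg : ∀ x, P (-x) = -P x := fun x => by simp [P]
  obtain ⟨x, hx, hgx⟩ := exists_eq_zero_of_odd hn (fun x => N (P x) - N (-P x))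
    ((hN.comp_continuousOn hP).sub (hN.comp_continuousOn hP.neg))
    (fun x => by simp only [hPneg, neg_neg, neg_sub])
  refine ⟨P x, ?_, sub_eq_zero.1 hgx⟩
  have hTx : ‖T x‖ ≠ 0 := by simpa using hx
  rw [norm_smul, norm_div, norm_norm, Real.norm_of_nonneg hr, div_mul_cancel₀ _ hTx]
end

section
/- Let F and G be real normed vector spaces and let S : F → G be a homogeneous map, i.e. S(α·f) = α·S(f) for all α ∈ ℝ and f ∈ F. Suppose V ⊆ F is a linear subspace with dim V = s ∈ ℕ, s ≥ 1, and a ≥ 0 is a constant such that a·‖f‖_F ≤ ‖S(f)‖_G for all f ∈ V. Then for every n ∈ ℕ with n < s, every map φ : ℝⁿ → G, every r ≥ 0, and every information map N : F → ℝⁿ that is either (i) continuous, or (ii) of adaptive linear form, meaning N(f) = (y₁,…,yₙ) where y₁ = L₁(f) and y_j = L_j(f; y₁,…,y_{j−1}) with each L_j(·; y₁,…,y_{j−1}) : F → ℝ linear, there exists f ∈ F with ‖f‖_F ≤ r and ‖S(f) − φ(N(f))‖_G ≥ a·r. In particular, for every such algorithm A = φ∘N one has sup_{‖f‖_F ≤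 1} ‖S(f) − A(f)‖_G ≥ a. -/
/-- An information map `N : F → ℝⁿ` is of *adaptive linear form* if
`N f j = L_j(f; y₁, …, y_{j-1})` where `y_i = N f i` and each
`L_j(·; y₁, …, y_{j-1})` is linear in `f`. -/
def IsAdaptiveLinear {F : Type*} [AddCommGroup F] [Module ℝ F] {n : ℕ}
    (N : F → (Fin n → ℝ)) : Prop :=
  ∃ L : (j : Fin n) → (Fin (j : ℕ) → ℝ) → (F →ₗ[ℝ] ℝ),
    ∀ (f : F) (j : Fin n),
      N f j = L j (fun i : Fin (j : ℕ) => N f ⟨i, i.isLt.trans j.isLt⟩) f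

/-- A commutative real algebra acting on a real vector space of odd finite dimension has a real
point. -/
theorem exists_algHom_of_odd_finrank_module {B : Type*} [CommRing B] [Algebra ℝ B]
    {M : Type*} [AddCommGroup M] [Module ℝ M] [Module B M] [IsScalarTower ℝ B M]
    (hM : Odd (Module.finrank ℝ M)) (hB : Module.Finite ℝ B) : Nonempty (B →ₐ[ℝ] ℝ) := by
  induction hk : Module.finrank ℝ M using Nat.strong_induction_on generalizing M with
  | _ k ih =>
    have : Module.Finite ℝ M := Module.finite_of_finrank_pos hM.pos
    by_cases hs : IsSimpleModule B M
    · obtain ⟨I, hI, ⟨e⟩⟩ := isSimpleModule_iff_quot_maximal.1 hs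
      let := Ideal.Quotient.field I
      have hfin : Module.finrank ℝ M = Module.finrank ℝ (B ⧸ I) :=
        (e.restrictScalars ℝ).finrank_eq
      rcases Real.nonempty_algEquiv_or (B ⧸ I) with ⟨⟨f⟩⟩ | ⟨⟨f⟩⟩
      · exact ⟨f.toAlgHom.comp (Ideal.Quotient.mkₐ ℝ I)⟩
      · rw [hfin, f.toLinearEquiv.finrank_eq, Complex.finrank_real_complex] at hM
        exact absurd hM (by decide)
    · have : Nontrivial M := Module.nontrivial_of_finrank_pos (R := ℝ) hM.pos
      obtain ⟨N, hN0, hN1⟩ : ∃ N : Submodule B M, N ≠ ⊥ ∧ N ≠ ⊤ := by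
        by_contra! h
        exact hs ((isSimpleModule_iff _ _).2 ⟨fun N => or_iff_not_imp_left.2 (h N)⟩)
      have hadd := Submodule.finrank_quotient_add_finrank (N.restrictScalars ℝ)
      change Module.finrank ℝ (M ⧸ N) + Module.finrank ℝ N = _ at hadd
      have hNpos : 0 < Module.finrank ℝ N := by
        have : Nontrivial (N.restrictScalars ℝ) := (Submodule.nontrivial_iff_ne_bot (p := N)).2 hN0
        exact Module.finrank_pos (R := ℝ) (M := N.restrictScalars ℝ)
      have hQpos : 0 < Module.finrank ℝ (M ⧸ N) := by
        have : Nontrivial (M ⧸ N.restrictScalars ℝ) :=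
          (Submodule.Quotient.nontrivial_iff (p := N)).2 hN1
        exact Module.finrank_pos (R := ℝ) (M := M ⧸ N.restrictScalars ℝ)
      rcases Nat.even_or_odd (Module.finrank ℝ N) with h | h
      · refine ih _ (by omega) (M := M ⧸ N) ?_ rfl
        rw [← hadd] at hM
        exact (Nat.odd_add.1 hM).2 h
      · exact ih _ (by omega) (M := N) h rfl

theorem exists_algHom_of_odd_finrank {B : Type*} [CommRing B] [Algebra ℝ B]
    (h : Odd (Module.finrank ℝ B)) : Nonempty (B →ₐ[ℝ] ℝ) :=
  exists_algHom_of_odd_finrank_module (M := B) h (Module.finite_of_finrank_pos h.pos)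

theorem exists_algHom_of_odd_finrank_quotient {A : Type*} [CommRing A] [Algebra ℝ A]
    (J : Ideal A) (h : Odd (Module.finrank ℝ (A ⧸ J))) :
    ∃ ψ : A →ₐ[ℝ] ℝ, ∀ p ∈ J, ψ p = 0 := by
  obtain ⟨χ⟩ := exists_algHom_of_odd_finrank h
  refine ⟨χ.comp (Ideal.Quotient.mkₐ ℝ J), fun p hp => ?_⟩
  rw [AlgHom.comp_apply, Ideal.Quotient.mkₐ_eq_mk, Ideal.Quotient.eq_zero_iff_mem.2 hp, map_zero]

section EvenPolynomials

open MvPolynomial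

/-- The substitution `x ↦ -x` on polynomials. -/
noncomputable def negHom (ι : Type*) : MvPolynomial ι ℝ →ₐ[ℝ] MvPolynomial ι ℝ :=
  aeval fun i => -X i

/-- The subalgebra of even polynomials. -/
noncomputable def evenPoly (ι : Type*) : Subalgebra ℝ (MvPolynomial ι ℝ) :=
  AlgHom.equalizer (negHom ι) (AlgHom.id ℝ _)

theorem negHom_X {ι : Type*} (i : ι) : negHom ι (X i) = -X i := by simp [negHom]

theorem negHom_monomial {ι : Type*} (γ : ι →₀ ℕ) :
    negHom ι (monomial γ 1) = (-1 : ℝ) ^ γ.degree • monomial γ 1 := by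
  rw [negHom, aeval_monomial]
  simp only [map_one, one_mul, Finsupp.prod]
  simp_rw [neg_pow (X _ : MvPolynomial ι ℝ)]
  rw [Finset.prod_mul_distrib, Finset.prod_pow_eq_pow_sum, monomial_eq]
  simp [Finsupp.degree_apply, Finsupp.prod, Algebra.smul_def]

theorem coeff_negHom {ι : Type*} (p : MvPolynomial ι ℝ) (γ : ι →₀ ℕ) :
    coeff γ (negHom ι p) = (-1 : ℝ) ^ γ.degree * coeff γ p := by
  classical
  induction p using MvPolynomial.induction_on' with
  | monomial δ c =>
    have : monomial δ c = c • (monomial δ 1 : MvPolynomial ι ℝ) := by simp [smul_monomial]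
    rw [this, map_smul, negHom_monomial]
    simp only [coeff_smul, coeff_monomial, smul_eq_mul]
    split_ifs with h
    · subst h; ring
    · ring
  | add p q hp hq => rw [map_add, coeff_add, coeff_add, hp, hq]; ring

theorem negHom_negHom {ι : Type*} (p : MvPolynomial ι ℝ) : negHom ι (negHom ι p) = p := by
  ext γ
  rw [coeff_negHom, coeff_negHom, ← mul_assoc, ← mul_pow]
  simp

theorem mem_evenPoly_iff {ι : Type*} {p : MvPolynomial ι ℝ} :
    p ∈ evenPoly ι ↔ negHom ι p = p := Iff.rfl

theorem mem_evenPoly_iff_restrictSupport {ι : Type*} {p : MvPolynomial ι ℝ} :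
    p ∈ evenPoly ι ↔ p ∈ restrictSupport ℝ {γ : ι →₀ ℕ | Even γ.degree} := by
  rw [mem_evenPoly_iff, mem_restrictSupport_iff]
  constructor
  · intro h γ hγ
    have h1 := coeff_negHom p γ
    rw [h] at h1
    by_contra h2
    rw [Set.mem_ofPred_eq, Nat.not_even_iff_odd] at h2
    rw [h2.neg_one_pow] at h1
    exact (mem_support_iff.1 hγ) (by linarith)
  · intro h
    ext γ
    rw [coeff_negHom]
    by_cases hγ : γ ∈ p.support
    · have : Even γ.degree := h hγ
      rw [this.neg_one_pow, one_mul]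
    · rw [notMem_support_iff.1 hγ, mul_zero]

/-- A real character of the algebra of even polynomials which sends `∑ xᵢ²` to `1` is
evaluation at a point. -/
theorem exists_eval_of_algHom_evenPoly {ι : Type*} [Fintype ι] (χ : evenPoly ι →ₐ[ℝ] ℝ)
    (hχ : ∀ p : evenPoly ι, (p : MvPolynomial ι ℝ) = ∑ i, X i ^ 2 - 1 → χ p = 0) :
    ∃ y : ι → ℝ, ∑ i, y i ^ 2 = 1 ∧ ∀ p : evenPoly ι, χ p = eval y (p : MvPolynomial ι ℝ) := by
  have hxx : ∀ i j : ι, (X i * X j : MvPolynomial ι ℝ) ∈ evenPoly ι := fun i j => by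
    rw [mem_evenPoly_iff, map_mul, negHom_X, negHom_X]; ring
  let m : ι → ι → ℝ := fun i j => χ ⟨_, hxx i j⟩
  have hsum : ∑ i, m i i = 1 := by
    have := hχ (∑ i, ⟨_, hxx i i⟩ - 1) (by simp [sq])
    rw [map_sub, map_sum, map_one] at this
    linarith
  obtain ⟨k, hk⟩ : ∃ k, 0 < m k k := by
    by_contra! h
    have := Finset.sum_nonpos fun i (_ : i ∈ Finset.univ) => h i
    linarith
  set c := √(m k k) with hc
  have hcpos : 0 < c := Real.sqrt_pos.2 hk
  have hcc : c * c = m k k := Real.mul_self_sqrt hk.le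
  let y : ι → ℝ := fun i => m k i / c
  have hy : ∀ i, m k i = c * y i := fun i => by simp only [y]; field_simp
  have key : ∀ p : MvPolynomial ι ℝ,
      (∀ hp : p + negHom ι p ∈ evenPoly ι,
        χ ⟨_, hp⟩ = eval y (p + negHom ι p)) ∧
      (∀ hp : X k * (p - negHom ι p) ∈ evenPoly ι,
        χ ⟨_, hp⟩ = c * eval y (p - negHom ι p)) := by
    intro p
    induction p using MvPolynomial.induction_on with
    | C a =>
      constructor
      · intro hp
        have : (⟨_, hp⟩ : evenPoly ι) = algebraMap ℝ _ (a + a) := by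
          ext1; simp [negHom, MvPolynomial.algebraMap_eq]
        rw [this, AlgHom.commutes]; simp [negHom]
      · intro hp
        have : (⟨_, hp⟩ : evenPoly ι) = 0 := by
          ext1; simp [negHom]
        rw [this, map_zero]; simp [negHom]
    | add p q hp hq =>
      constructor
      · intro h
        have h1 : p + negHom ι p ∈ evenPoly ι := by
          rw [mem_evenPoly_iff, map_add, negHom_negHom, add_comm]
        have h2 : q + negHom ι q ∈ evenPoly ι := by
          rw [mem_evenPoly_iff, map_add, negHom_negHom, add_comm]
        have : (⟨_, h⟩ : evenPoly ι) = ⟨_, h1⟩ + ⟨_, h2⟩ := by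
          ext1; simp only [map_add, AddMemClass.mk_add_mk]; ring
        rw [this, map_add, hp.1, hq.1]; simp only [map_add]; ring
      · intro h
        have h1 : X k * (p - negHom ι p) ∈ evenPoly ι := by
          rw [mem_evenPoly_iff, map_mul, map_sub, negHom_negHom, negHom_X]; ring
        have h2 : X k * (q - negHom ι q) ∈ evenPoly ι := by
          rw [mem_evenPoly_iff, map_mul, map_sub, negHom_negHom, negHom_X]; ring
        have : (⟨_, h⟩ : evenPoly ι) = ⟨_, h1⟩ + ⟨_, h2⟩ := by
          ext1; simp only [map_add, AddMemClass.mk_add_mk]; ring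
        rw [this, map_add, hp.2, hq.2]; simp only [map_add, map_sub]; ring
    | mul_X p i hp =>
      have h1 : p + negHom ι p ∈ evenPoly ι := by
        rw [mem_evenPoly_iff, map_add, negHom_negHom, add_comm]
      have h2 : X k * (p - negHom ι p) ∈ evenPoly ι := by
        rw [mem_evenPoly_iff, map_mul, map_sub, negHom_negHom, negHom_X]; ring
      constructor
      · intro h
        have : (⟨_, h⟩ : evenPoly ι) * ⟨_, hxx k k⟩ = ⟨_, h2⟩ * ⟨_, hxx k i⟩ := by
          ext1; simp only [map_mul, MulMemClass.mk_mul_mk, negHom_X]; ring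
        have h3 := congrArg χ this
        rw [map_mul χ, map_mul χ, hp.2] at h3
        change _ * m k k = _ * m k i at h3
        rw [hy i, ← hcc] at h3
        have : eval y (p * X i + negHom ι (p * X i)) = eval y (p - negHom ι p) * y i := by
          simp only [map_mul, map_add, map_sub, negHom_X, map_neg, eval_X]; ring
        rw [this]
        apply mul_right_cancel₀ (mul_ne_zero hcpos.ne' hcpos.ne')
        rw [h3]; ring
      · intro h
        have : (⟨_, h⟩ : evenPoly ι) = ⟨_, h1⟩ * ⟨_, hxx k i⟩ := by
          ext1; simp only [map_mul, MulMemClass.mk_mul_mk, negHom_X]; ring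
        rw [this, map_mul, hp.1]
        change _ * m k i = _
        rw [hy i]
        simp only [map_mul, map_add, map_sub, negHom_X, map_neg, eval_X]; ring
  have hev : ∀ p : evenPoly ι, χ p = eval y (p : MvPolynomial ι ℝ) := by
    rintro ⟨p, hp⟩
    have hp' : negHom ι p = p := hp
    have h1 : p + negHom ι p ∈ evenPoly ι := by
      rw [hp']; exact add_mem hp hp
    have h2 := (key p).1 h1
    have h3 : (⟨_, h1⟩ : evenPoly ι) = ⟨p, hp⟩ + ⟨p, hp⟩ := by
      ext1; simp [hp']
    rw [h3, map_add, hp', map_add] at h2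
    simp only
    linarith
  refine ⟨y, ?_, hev⟩
  have h1 : ∀ i, m i i = y i ^ 2 := fun i => by
    rw [sq]; simpa using hev ⟨_, hxx i i⟩
  rw [← hsum]
  exact Finset.sum_congr rfl fun i _ => (h1 i).symm

/-- Polynomials all of whose monomials have `w`-weight less than `m`. -/
noncomputable def weightBelow {ι : Type*} (w : ι → ℕ) (m : ℕ) : Submodule ℝ (MvPolynomial ι ℝ) :=
  restrictSupport ℝ {γ | Finsupp.weight w γ < m}

theorem weightBelow_mono {ι : Type*} (w : ι → ℕ) {m k : ℕ} (h : m ≤ k) :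
    weightBelow w m ≤ weightBelow w k :=
  restrictSupport_mono _ fun _ hγ => lt_of_lt_of_le hγ h

theorem mul_mem_weightBelow {ι : Type*} {w : ι → ℕ} {a b : ℕ} {p q : MvPolynomial ι ℝ}
    (hp : p ∈ weightBelow w a) (hq : q ∈ weightBelow w (b + 1)) :
    p * q ∈ weightBelow w (a + b) := by
  classical
  rw [weightBelow, mem_restrictSupport_iff] at *
  intro γ hγ
  obtain ⟨δ, hδ, ε, hε, rfl⟩ := Finset.mem_add.1 (support_mul p q hγ)
  have h1 : Finsupp.weight w δ < a := hp hδ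
  have h2 : Finsupp.weight w ε < b + 1 := hq hε
  change Finsupp.weight w (δ + ε) < a + b
  rw [map_add]
  omega

/-- `p` is the monomial `x ^ γ` plus terms of strictly smaller `w`-weight. -/
def HasLeading {ι : Type*} (w : ι → ℕ) (p : MvPolynomial ι ℝ) (γ : ι →₀ ℕ) : Prop :=
  p - monomial γ 1 ∈ weightBelow w (Finsupp.weight w γ)

theorem monomial_mem_weightBelow {ι : Type*} (w : ι → ℕ) (γ : ι →₀ ℕ) :
    monomial γ (1 : ℝ) ∈ weightBelow w (Finsupp.weight w γ + 1) :=
  (monomial_mem_restrictSupport ℝ).2 (Or.inl (Nat.lt_succ_self _))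

theorem HasLeading.monomial {ι : Type*} (w : ι → ℕ) (γ : ι →₀ ℕ) :
    HasLeading w (monomial γ 1) γ := by
  simp [HasLeading]

theorem HasLeading.mem {ι : Type*} {w : ι → ℕ} {p : MvPolynomial ι ℝ} {γ : ι →₀ ℕ}
    (h : HasLeading w p γ) : p ∈ weightBelow w (Finsupp.weight w γ + 1) := by
  have := add_mem (weightBelow_mono w (Nat.le_succ _) h) (monomial_mem_weightBelow w γ)
  rwa [sub_add_cancel] at this

theorem HasLeading.mul {ι : Type*} {w : ι → ℕ} {p q : MvPolynomial ι ℝ} {γ δ : ι →₀ ℕ}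
    (hp : HasLeading w p γ) (hq : HasLeading w q δ) : HasLeading w (p * q) (γ + δ) := by
  have h1 := mul_mem_weightBelow hp hq.mem
  have h2 := mul_mem_weightBelow hq (monomial_mem_weightBelow w γ)
  rw [add_comm] at h2
  rw [HasLeading, map_add]
  convert add_mem h1 h2 using 1
  rw [← one_mul (1 : ℝ), ← monomial_mul, one_mul]
  ring

theorem HasLeading.one {ι : Type*} (w : ι → ℕ) : HasLeading w 1 0 :=
  HasLeading.monomial w 0

theorem HasLeading.pow {ι : Type*} {w : ι → ℕ} {p : MvPolynomial ι ℝ} {γ : ι →₀ ℕ}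
    (hp : HasLeading w p γ) (k : ℕ) : HasLeading w (p ^ k) (k • γ) := by
  induction k with
  | zero => simpa using HasLeading.one w
  | succ k ih => rw [pow_succ, succ_nsmul]; exact ih.mul hp

theorem HasLeading.prod {ι κ : Type*} {w : ι → ℕ} (s : Finset κ) {p : κ → MvPolynomial ι ℝ}
    {γ : κ → ι →₀ ℕ} (h : ∀ i ∈ s, HasLeading w (p i) (γ i)) :
    HasLeading w (∏ i ∈ s, p i) (∑ i ∈ s, γ i) := by
  classical
  induction s using Finset.induction_on with
  | empty => simpa using HasLeading.one w
  | insert a s ha ih =>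
    rw [Finset.prod_insert ha, Finset.sum_insert ha]
    exact (h a (Finset.mem_insert_self _ _)).mul
      (ih fun i hi => h i (Finset.mem_insert_of_mem hi))

theorem linearMap_ext_monomial {ι M : Type*} [AddCommGroup M] [Module ℝ M]
    {f g : MvPolynomial ι ℝ →ₗ[ℝ] M} (h : ∀ γ, f (monomial γ 1) = g (monomial γ 1)) : f = g :=
  (basisMonomials ι ℝ).ext fun γ => by simpa using h γ

section Division

variable {ι : Type*} [Fintype ι] (d : ι → ℕ) (F : ι → MvPolynomial ι ℝ)

/-- The product obtained from `x ^ γ` by replacing each factor `xᵢ ^ dᵢ` by `Fᵢ`. -/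
noncomputable def powMonomial (γ : ι →₀ ℕ) : MvPolynomial ι ℝ :=
  ∏ i, (F i ^ (γ i / d i) * X i ^ (γ i % d i))

/-- The linear endomorphism replacing each factor `xᵢ ^ dᵢ` of a monomial by `Fᵢ`. -/
noncomputable def substPow : MvPolynomial ι ℝ →ₗ[ℝ] MvPolynomial ι ℝ :=
  (basisMonomials ι ℝ).constr ℝ (powMonomial d F)

theorem substPow_monomial (γ : ι →₀ ℕ) :
    substPow d F (monomial γ 1) = powMonomial d F γ := by
  have := (basisMonomials ι ℝ).constr_basis ℝ (powMonomial d F) γ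
  rwa [coe_basisMonomials] at this

variable {d F}

theorem hasLeading_powMonomial {w : ι → ℕ}
    (hF : ∀ i, HasLeading w (F i) (Finsupp.single i (d i))) (γ : ι →₀ ℕ) :
    HasLeading w (powMonomial d F γ) γ := by
  have h := HasLeading.prod (w := w) Finset.univ
    (p := fun i => F i ^ (γ i / d i) * X i ^ (γ i % d i))
    (γ := fun i => (γ i / d i) • Finsupp.single i (d i) + (γ i % d i) • Finsupp.single i 1)
    fun i _ => ((hF i).pow _).mul ((HasLeading.monomial w (Finsupp.single i 1)).pow _)
  have hγ : ∑ i, ((γ i / d i) • Finsupp.single i (d i) + (γ i % d i) • Finsupp.single i 1) = γ := by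
    refine (Finset.sum_congr rfl fun i _ => ?_).trans (Finsupp.univ_sum_single γ)
    rw [Finsupp.smul_single, Finsupp.smul_single, ← Finsupp.single_add]
    congr 1
    simp [Nat.div_add_mod']
  rwa [hγ] at h

theorem substPow_sub_self_mem {w : ι → ℕ}
    (hF : ∀ i, HasLeading w (F i) (Finsupp.single i (d i))) {m : ℕ} {p : MvPolynomial ι ℝ}
    (hp : p ∈ weightBelow w (m + 1)) : substPow d F p - p ∈ weightBelow w m := by
  rw [weightBelow, restrictSupport_eq_span] at hp
  induction hp using Submodule.span_induction with
  | mem x hx =>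
    obtain ⟨γ, hγ, rfl⟩ := hx
    simp only
    rw [substPow_monomial]
    exact weightBelow_mono w (Nat.lt_succ_iff.1 hγ) (hasLeading_powMonomial hF γ)
  | zero => simp
  | add x y _ _ hx hy =>
    rw [map_add, add_sub_add_comm]; exact add_mem hx hy
  | smul c x _ hx =>
    rw [map_smul, ← smul_sub]; exact Submodule.smul_mem _ c hx

theorem exists_mem_weightBelow {ι : Type*} (w : ι → ℕ) (p : MvPolynomial ι ℝ) :
    ∃ m, p ∈ weightBelow w m := by
  refine ⟨p.support.sup (Finsupp.weight w) + 1, fun γ hγ => ?_⟩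
  exact Nat.lt_succ_of_le (Finset.le_sup (f := Finsupp.weight w) hγ)

theorem weightBelow_zero {ι : Type*} {w : ι → ℕ} {p : MvPolynomial ι ℝ}
    (hp : p ∈ weightBelow w 0) : p = 0 := by
  rw [weightBelow, mem_restrictSupport_iff] at hp
  rw [← support_eq_empty]
  exact Finset.eq_empty_of_forall_notMem fun γ hγ => Nat.not_lt_zero _ (hp hγ)

theorem substPow_bijective {w : ι → ℕ}
    (hF : ∀ i, HasLeading w (F i) (Finsupp.single i (d i))) :
    Function.Bijective (substPow d F) := by
  constructor
  · rw [injective_iff_map_eq_zero]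
    intro p hp
    obtain ⟨m, hm⟩ := exists_mem_weightBelow w p
    induction m with
    | zero => exact weightBelow_zero hm
    | succ m ih =>
      have := substPow_sub_self_mem hF hm
      rw [hp, zero_sub, neg_mem_iff] at this
      exact ih this
  · intro p
    obtain ⟨m, hm⟩ := exists_mem_weightBelow w p
    induction m generalizing p with
    | zero => exact ⟨0, by rw [map_zero, weightBelow_zero hm]⟩
    | succ m ih =>
      obtain ⟨r, hr⟩ := ih _ (substPow_sub_self_mem hF hm)
      exact ⟨p - r, by rw [map_sub, hr]; abel⟩

theorem powMonomial_add_single [DecidableEq ι] (hd : ∀ i, 0 < d i) (γ : ι →₀ ℕ) (i : ι) :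
    powMonomial d F (γ + Finsupp.single i (d i)) = F i * powMonomial d F γ := by
  rw [powMonomial, powMonomial, ← Finset.mul_prod_erase _ _ (Finset.mem_univ i),
    ← Finset.mul_prod_erase (a := i) _ (fun j => F j ^ (γ j / d j) * X j ^ (γ j % d j))
      (Finset.mem_univ i), ← mul_assoc]
  congr 1
  · rw [Finsupp.add_apply, Finsupp.single_eq_same, Nat.add_div_right _ (hd i), Nat.add_mod_right,
      pow_succ', mul_assoc]
  · refine Finset.prod_congr rfl fun j hj => ?_
    rw [Finsupp.add_apply, Finsupp.single_eq_of_ne (Finset.ne_of_mem_erase hj), add_zero]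

theorem substPow_X_pow_mul (hd : ∀ i, 0 < d i) (i : ι) (p : MvPolynomial ι ℝ) :
    substPow d F (X i ^ d i * p) = F i * substPow d F p := by
  classical
  have : (substPow d F) ∘ₗ LinearMap.mulLeft ℝ (X i ^ d i) =
      LinearMap.mulLeft ℝ (F i) ∘ₗ substPow d F := by
    refine linearMap_ext_monomial fun γ => ?_
    simp only [LinearMap.comp_apply, LinearMap.mulLeft_apply]
    rw [X_pow_eq_monomial, monomial_mul, one_mul, substPow_monomial, substPow_monomial, add_comm,
      powMonomial_add_single hd]
  exact LinearMap.congr_fun this p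

theorem negHom_substPow (hF : ∀ i, negHom ι (F i) = (-1 : ℝ) ^ d i • F i)
    (p : MvPolynomial ι ℝ) : negHom ι (substPow d F p) = substPow d F (negHom ι p) := by
  have : (negHom ι).toLinearMap ∘ₗ substPow d F = substPow d F ∘ₗ (negHom ι).toLinearMap := by
    refine linearMap_ext_monomial fun γ => ?_
    simp only [LinearMap.comp_apply, AlgHom.toLinearMap_apply]
    rw [negHom_monomial, map_smul, substPow_monomial, powMonomial, map_prod]
    simp_rw [map_mul, map_pow, hF, negHom_X]
    rw [Finsupp.degree_eq_sum, ← Finset.prod_pow_eq_pow_sum, ← Finset.prod_smul]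
    refine Finset.prod_congr rfl fun i _ => ?_
    rw [smul_pow, neg_pow (X i : MvPolynomial ι ℝ), ← pow_mul]
    have h : (-1 : ℝ) ^ γ i = (-1) ^ (d i * (γ i / d i)) * (-1) ^ (γ i % d i) := by
      rw [← pow_add, Nat.div_add_mod]
    rw [h]
    simp only [Algebra.smul_def, map_mul, map_pow, map_neg, map_one]
    ring
  exact LinearMap.congr_fun this p

end Division

section NormalForm

variable {ι : Type*} [Fintype ι] {d : ι → ℕ} {F : ι → MvPolynomial ι ℝ}

open Classical in
/-- The projection onto the span of the monomials with all exponents less than `dᵢ`. -/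
noncomputable def normalPart (d : ι → ℕ) : MvPolynomial ι ℝ →ₗ[ℝ] MvPolynomial ι ℝ :=
  (basisMonomials ι ℝ).constr ℝ fun γ => if ∀ i, γ i < d i then monomial γ 1 else 0

open Classical in
theorem normalPart_monomial (d : ι → ℕ) (γ : ι →₀ ℕ) :
    normalPart d (monomial γ 1) = if ∀ i, γ i < d i then monomial γ 1 else 0 := by
  have := (basisMonomials ι ℝ).constr_basis ℝ
    (fun γ => if ∀ i, γ i < d i then monomial γ (1 : ℝ) else 0) γ
  rwa [coe_basisMonomials] at this

theorem normalPart_X_pow_mul (d : ι → ℕ) (i : ι) (p : MvPolynomial ι ℝ) :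
    normalPart d (X i ^ d i * p) = 0 := by
  have : normalPart d ∘ₗ LinearMap.mulLeft ℝ (X i ^ d i) = 0 := by
    refine linearMap_ext_monomial fun γ => ?_
    simp only [LinearMap.comp_apply, LinearMap.mulLeft_apply, LinearMap.zero_apply]
    rw [X_pow_eq_monomial, monomial_mul, one_mul, normalPart_monomial, if_neg]
    intro h
    have := h i
    simp at this
  exact LinearMap.congr_fun this p

theorem substPow_sub_normalPart_mem (hd : ∀ i, 0 < d i) (p : MvPolynomial ι ℝ) :
    substPow d F (p - normalPart d p) ∈ Ideal.span (Set.range F) := by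
  induction p using MvPolynomial.induction_on' with
  | monomial γ c =>
    have : monomial γ c = c • (monomial γ 1 : MvPolynomial ι ℝ) := by simp [smul_monomial]
    rw [this, map_smul, ← smul_sub, map_smul, normalPart_monomial]
    refine Submodule.smul_of_tower_mem _ c ?_
    split_ifs with h
    · simp
    · push Not at h
      obtain ⟨i, hi⟩ := h
      rw [sub_zero, substPow_monomial, powMonomial]
      refine Ideal.mem_of_dvd _ (Finset.dvd_prod_of_mem _ (Finset.mem_univ i)) ?_
      refine Ideal.mul_mem_right _ _ (Ideal.pow_mem_of_mem _
        (Ideal.subset_span (Set.mem_range_self i)) _ ?_)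
      exact Nat.div_pos hi (hd i)
  | add p q hp hq =>
    rw [map_add, add_sub_add_comm, map_add]; exact add_mem hp hq

theorem substPow_mem_span_iff (hd : ∀ i, 0 < d i) (hb : Function.Bijective (substPow d F))
    {p : MvPolynomial ι ℝ} :
    substPow d F p ∈ Ideal.span (Set.range F) ↔ normalPart d p = 0 := by
  constructor
  · intro h
    obtain ⟨c, hc⟩ := Ideal.mem_span_range_iff_exists_fun.1 h
    choose r hr using fun i => hb.2 (c i)
    have : p = ∑ i, X i ^ d i * r i := by
      apply hb.1
      rw [← hc, map_sum]
      refine Finset.sum_congr rfl fun i _ => ?_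
      rw [substPow_X_pow_mul hd, hr, mul_comm]
    rw [this, map_sum]
    exact Finset.sum_eq_zero fun i _ => normalPart_X_pow_mul d i _
  · intro h
    have := substPow_sub_normalPart_mem (F := F) hd p
    rwa [h, sub_zero] at this

/-- Exponents of even total degree with all entries less than `dᵢ`. -/
def evenNormal (d : ι → ℕ) : Set (ι →₀ ℕ) := {γ | Even γ.degree ∧ ∀ i, γ i < d i}

theorem normalPart_mem {p : MvPolynomial ι ℝ} (hp : p ∈ evenPoly ι) :
    normalPart d p ∈ restrictSupport ℝ (evenNormal d) := by
  rw [mem_evenPoly_iff_restrictSupport, restrictSupport_eq_span] at hp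
  induction hp using Submodule.span_induction with
  | mem x hx =>
    obtain ⟨γ, hγ, rfl⟩ := hx
    simp only
    rw [normalPart_monomial]
    split_ifs with h
    · exact (monomial_mem_restrictSupport ℝ).2 (Or.inl ⟨hγ, h⟩)
    · exact zero_mem _
  | zero => simp
  | add x y _ _ hx hy => rw [map_add]; exact add_mem hx hy
  | smul c x _ hx => rw [map_smul]; exact Submodule.smul_mem _ c hx

theorem normalPart_eq_self {p : MvPolynomial ι ℝ} (hp : p ∈ restrictSupport ℝ (evenNormal d)) :
    normalPart d p = p := by
  rw [restrictSupport_eq_span] at hp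
  induction hp using Submodule.span_induction with
  | mem x hx =>
    obtain ⟨γ, hγ, rfl⟩ := hx
    simp only
    rw [normalPart_monomial, if_pos hγ.2]
  | zero => simp
  | add x y _ _ hx hy => rw [map_add, hx, hy]
  | smul c x _ hx => rw [map_smul, hx]

theorem finrank_evenPoly_quotient (hd : ∀ i, 0 < d i)
    (hb : Function.Bijective (substPow d F))
    (hneg : ∀ i, negHom ι (F i) = (-1 : ℝ) ^ d i • F i) :
    Module.finrank ℝ (evenPoly ι ⧸ (Ideal.span (Set.range F)).comap (evenPoly ι).val) =
      Nat.card (evenNormal d) := by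
  let e := LinearEquiv.ofBijective (substPow d F) hb
  let f : evenPoly ι →ₗ[ℝ] MvPolynomial ι ℝ :=
    normalPart d ∘ₗ e.symm.toLinearMap ∘ₗ (evenPoly ι).val.toLinearMap
  have hsubst : ∀ r, substPow d F r ∈ evenPoly ι ↔ r ∈ evenPoly ι := fun r => by
    rw [mem_evenPoly_iff, negHom_substPow hneg, hb.1.eq_iff, mem_evenPoly_iff]
  have hsymm : ∀ p, substPow d F (e.symm p) = p := fun p => e.apply_symm_apply p
  have hker : LinearMap.ker f =
      ((Ideal.span (Set.range F)).comap (evenPoly ι).val).restrictScalars ℝ := by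
    ext p
    rw [LinearMap.mem_ker, Submodule.restrictScalars_mem, Ideal.mem_comap]
    change normalPart d (e.symm (p : MvPolynomial ι ℝ)) = 0 ↔
      (p : MvPolynomial ι ℝ) ∈ Ideal.span (Set.range F)
    rw [← substPow_mem_span_iff hd hb, hsymm]
  have hrange : LinearMap.range f = restrictSupport ℝ (evenNormal d) := by
    ext p
    constructor
    · rintro ⟨⟨q, hq⟩, rfl⟩
      exact normalPart_mem ((hsubst (e.symm q)).1 (by rw [hsymm]; exact hq))
    · intro hp
      have hp' : p ∈ evenPoly ι := mem_evenPoly_iff_restrictSupport.2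
        (restrictSupport_mono ℝ (fun γ hγ => hγ.1) hp)
      refine ⟨⟨_, (hsubst p).2 hp'⟩, ?_⟩
      change normalPart d (e.symm (e p)) = p
      rw [e.symm_apply_apply, normalPart_eq_self hp]
  have h1 := f.quotKerEquivRange.finrank_eq
  rw [hker, hrange, Module.finrank_eq_nat_card_basis (basisRestrictSupport ℝ (evenNormal d))] at h1
  exact h1

/-- A system of even and odd polynomials with an odd number of even normal monomials, one of
which defines the unit sphere, has a common real zero. -/
theorem exists_common_zero_of_odd_card {w : ι → ℕ} (hd : ∀ i, 0 < d i)
    (hF : ∀ i, HasLeading w (F i) (Finsupp.single i (d i)))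
    (hneg : ∀ i, negHom ι (F i) = (-1 : ℝ) ^ d i • F i)
    (hodd : Odd (Nat.card (evenNormal d))) {k : ι} (hk : F k = ∑ i, X i ^ 2 - 1) :
    ∃ y : ι → ℝ, ∑ i, y i ^ 2 = 1 ∧ ∀ i, eval y (F i) = 0 := by
  rw [← finrank_evenPoly_quotient hd (substPow_bijective hF) hneg] at hodd
  obtain ⟨ψ, hψ'⟩ := exists_algHom_of_odd_finrank_quotient _ hodd
  have hψ : ∀ p : evenPoly ι, (p : MvPolynomial ι ℝ) ∈ Ideal.span (Set.range F) → ψ p = 0 :=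
    fun p hp => hψ' p hp
  obtain ⟨y, hy, hev⟩ := exists_eval_of_algHom_evenPoly ψ fun p hp => hψ p (by
    rw [hp, ← hk]; exact Ideal.subset_span (Set.mem_range_self k))
  refine ⟨y, hy, fun i => ?_⟩
  have hsq : F i ^ 2 ∈ evenPoly ι := by
    rw [mem_evenPoly_iff, map_pow, hneg, smul_pow, ← pow_mul, mul_comm, pow_mul]
    simp
  have h := hev ⟨_, hsq⟩
  rw [hψ _ (Ideal.pow_mem_of_mem _ (Ideal.subset_span (Set.mem_range_self i)) 2 two_pos),
    map_pow] at h
  exact pow_eq_zero_iff two_ne_zero |>.1 h.symm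

end NormalForm

theorem eval_negHom {ι : Type*} (x : ι → ℝ) (p : MvPolynomial ι ℝ) :
    eval x (negHom ι p) = eval (-x) p := by
  induction p using MvPolynomial.induction_on with
  | C a => simp [negHom]
  | add p q hp hq => rw [map_add, map_add, map_add, hp, hq]
  | mul_X p i hp => rw [map_mul, map_mul, map_mul, hp, negHom_X]; simp

theorem card_evenNormal_cons (n D : ℕ) :
    Nat.card (evenNormal (Fin.cons 2 fun _ => D : Fin (n + 1) → ℕ)) = D ^ n := by
  have e : evenNormal (Fin.cons 2 fun _ => D : Fin (n + 1) → ℕ) ≃ (Fin n → Fin D) :=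
    { toFun := fun γ i => ⟨γ.1 i.succ, by simpa using γ.2.2 i.succ⟩
      invFun := fun α => ⟨Finsupp.equivFunOnFinite.symm
          (Fin.cons ((∑ i, (α i : ℕ)) % 2) fun i => (α i : ℕ)), by
        constructor
        · rw [Finsupp.degree_eq_sum, Fin.sum_univ_succ, Nat.even_iff]
          simp only [Finsupp.coe_equivFunOnFinite_symm, Fin.cons_zero, Fin.cons_succ]
          omega
        · intro i
          refine Fin.cases ?_ (fun i => ?_) i
          · simpa using Nat.mod_lt _ two_pos
          · simp⟩
      left_inv := by
        rintro ⟨γ, hγ, hlt⟩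
        ext i
        rw [Finsupp.degree_eq_sum, Fin.sum_univ_succ, Nat.even_iff] at hγ
        have h0 : γ 0 < 2 := by simpa using hlt 0
        refine Fin.cases ?_ (fun i => ?_) i
        · simp only [Finsupp.coe_equivFunOnFinite_symm, Fin.cons_zero]
          omega
        · simp
      right_inv := fun α => by ext i; simp }
  rw [Nat.card_congr e]
  simp

/-- Borsuk–Ulam for odd polynomial maps, up to an arbitrarily small error. -/
theorem exists_abs_eval_le_of_odd {n : ℕ} (f : Fin n → MvPolynomial (Fin (n + 1)) ℝ)
    (hf : ∀ i, negHom _ (f i) = -f i) {ε : ℝ} (hε : 0 < ε) :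
    ∃ y : Fin (n + 1) → ℝ, ∑ i, y i ^ 2 = 1 ∧ ∀ i, |eval y (f i)| ≤ ε := by
  let w : Fin (n + 1) → ℕ := Fin.cons 2 fun _ => 1
  choose m hm using fun i => exists_mem_weightBelow w (f i)
  let D := 2 * (∑ i, m i) + 1
  have hDodd : Odd D := ⟨_, rfl⟩
  have hmD : ∀ i, m i ≤ D := fun i => by
    have := Finset.single_le_sum (f := m) (fun _ _ => Nat.zero_le _) (Finset.mem_univ i)
    omega
  let d : Fin (n + 1) → ℕ := Fin.cons 2 fun _ => D
  let F : Fin (n + 1) → MvPolynomial (Fin (n + 1)) ℝ :=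
    Fin.cons (∑ i, X i ^ 2 - 1) fun i => X i.succ ^ D + ε⁻¹ • f i
  have hd : ∀ i, 0 < d i := fun i => Fin.cases (by simp [d]) (fun i => by simp [d, D]) i
  have hF : ∀ i, HasLeading w (F i) (Finsupp.single i (d i)) := by
    refine Fin.cases ?_ fun i => ?_
    · have h : F 0 - monomial (Finsupp.single 0 (d 0)) 1 =
          ∑ i : Fin n, monomial (Finsupp.single i.succ 2) 1 - monomial 0 1 := by
        simp only [F, d, Fin.cons_zero]
        rw [Fin.sum_univ_succ]
        simp only [X_pow_eq_monomial, monomial_zero', C_1]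
        ring
      rw [HasLeading, h]
      refine sub_mem (sum_mem fun i _ => ?_) ?_ <;>
      · refine (monomial_mem_restrictSupport ℝ).2 (Or.inl ?_)
        simp [Finsupp.weight_single, w, d]
    · have h : F i.succ - monomial (Finsupp.single i.succ (d i.succ)) 1 = ε⁻¹ • f i := by
        simp [F, d, X_pow_eq_monomial]
      rw [HasLeading, h]
      refine Submodule.smul_mem _ _ (weightBelow_mono w ?_ (hm i))
      simpa [Finsupp.weight_single, w, d] using hmD i
  have hneg : ∀ i, negHom _ (F i) = (-1 : ℝ) ^ d i • F i := by
    refine Fin.cases ?_ fun i => ?_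
    · simp [F, d, negHom_X]
    · simp only [F, d, Fin.cons_succ, map_add, map_pow, negHom_X, map_smul, hf, hDodd.neg_pow,
        one_pow, neg_smul, one_smul, smul_neg, neg_add]
  have hodd : Odd (Nat.card (evenNormal d)) := by
    rw [card_evenNormal_cons]; exact hDodd.pow
  obtain ⟨y, hy, hz⟩ := exists_common_zero_of_odd_card hd hF hneg hodd (k := 0) rfl
  refine ⟨y, hy, fun i => ?_⟩
  have h := hz i.succ
  simp only [F, Fin.cons_succ, map_add, map_pow, eval_X, smul_eval] at h
  have hyi : |y i.succ| ≤ 1 := by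
    rw [← sq_le_one_iff_abs_le_one, ← hy]
    exact Finset.single_le_sum (f := fun j => y j ^ 2) (fun _ _ => sq_nonneg _)
      (Finset.mem_univ i.succ)
  have h2 : eval y (f i) = -(ε * y i.succ ^ D) := by
    field_simp at h
    linarith
  rw [h2, abs_neg, abs_mul, abs_of_pos hε, abs_pow]
  exact mul_le_of_le_one_right hε.le (pow_le_one₀ (abs_nonneg _) hyi)

theorem exists_eval_near_of_continuousOn {ι : Type*} {K : Set (ι → ℝ)}
    (hK : IsCompact K) {h : (ι → ℝ) → ℝ} (hh : ContinuousOn h K) {ε : ℝ} (hε : 0 < ε) :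
    ∃ p : MvPolynomial ι ℝ, ∀ x ∈ K, |eval x p - h x| < ε := by
  have : CompactSpace K := isCompact_iff_compactSpace.1 hK
  let c : ι → C(K, ℝ) := fun i => ⟨fun x => x.1 i, (continuous_apply i).comp continuous_subtype_val⟩
  let A : Subalgebra ℝ C(K, ℝ) := (aeval c).range
  have hA : A.SeparatesPoints := by
    intro x y hxy
    obtain ⟨i, hi⟩ : ∃ i, x.1 i ≠ y.1 i := by
      by_contra! h
      exact hxy (Subtype.ext (funext h))
    exact ⟨c i, ⟨c i, ⟨X i, by simp⟩, rfl⟩, hi⟩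
  obtain ⟨⟨_, p, rfl⟩, hg⟩ :=
    ContinuousMap.exists_mem_subalgebra_near_continuous_of_separatesPoints A hA (K.domRestrict h)
      hh.domRestrict ε hε
  refine ⟨p, fun x hx => ?_⟩
  have hev : ∀ q : MvPolynomial ι ℝ, (aeval c q : C(K, ℝ)) ⟨x, hx⟩ = eval x q := fun q => by
    induction q using MvPolynomial.induction_on with
    | C a => simp
    | add p q hp hq => rw [map_add, map_add, ContinuousMap.add_apply, hp, hq]
    | mul_X p i hp => rw [map_mul, map_mul, ContinuousMap.mul_apply, hp]; simp [c]
  have := hg ⟨x, hx⟩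
  rw [← hev]
  exact this

theorem isCompact_sum_sq_eq_one (ι : Type*) [Fintype ι] :
    IsCompact {x : ι → ℝ | ∑ i, x i ^ 2 = 1} := by
  refine Metric.isCompact_of_isClosed_isBounded
    (isClosed_eq (by fun_prop) continuous_const)
    ((Metric.isBounded_closedBall (x := 0) (r := 1)).subset ?_)
  intro x hx
  rw [mem_closedBall_zero_iff, pi_norm_le_iff_of_nonneg zero_le_one]
  intro i
  rw [Real.norm_eq_abs, ← sq_le_one_iff_abs_le_one, ← (hx : ∑ i, x i ^ 2 = 1)]
  exact Finset.single_le_sum (f := fun j => x j ^ 2) (fun _ _ => sq_nonneg _) (Finset.mem_univ i)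

/-- The Borsuk–Ulam theorem: a continuous odd map from the `n`-sphere to `ℝⁿ` has a zero. -/
theorem borsukUlam {n : ℕ} (g : (Fin (n + 1) → ℝ) → Fin n → ℝ)
    (hg : ContinuousOn g {x | ∑ i, x i ^ 2 = 1})
    (hodd : ∀ x, ∑ i, x i ^ 2 = 1 → g (-x) = -g x) :
    ∃ y, ∑ i, y i ^ 2 = 1 ∧ g y = 0 := by
  set K : Set (Fin (n + 1) → ℝ) := {x | ∑ i, x i ^ 2 = 1} with hKdef
  have hK : IsCompact K := isCompact_sum_sq_eq_one _
  have hnegK : ∀ x ∈ K, -x ∈ K := fun x hx => by simpa [K] using hx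
  have hsmall : ∀ ε : ℝ, 0 < ε → ∃ y ∈ K, ‖g y‖ ≤ 2 * ε := by
    intro ε hε
    choose p hp using fun i => exists_eval_near_of_continuousOn hK
      (h := fun x => g x i) ((continuousOn_pi.1 hg) i) hε
    obtain ⟨y, hy, hfy⟩ := exists_abs_eval_le_of_odd
      (fun i => (2⁻¹ : ℝ) • (p i - negHom _ (p i)))
      (fun i => by rw [map_smul, map_sub, negHom_negHom, ← smul_neg, neg_sub]) hε
    refine ⟨y, hy, (pi_norm_le_iff_of_nonneg (by positivity)).2 fun i => ?_⟩
    have h1 := hp i y hy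
    have h2 := hp i (-y) (hnegK y hy)
    have h3 := hfy i
    rw [smul_eval, map_sub, eval_negHom] at h3
    rw [hodd y hy, Pi.neg_apply] at h2
    rw [Real.norm_eq_abs]
    rw [abs_lt] at h1 h2
    rw [abs_le] at h3 ⊢
    constructor <;> linarith
  have hne : K.Nonempty := let ⟨y, hy, _⟩ := hsmall 1 one_pos; ⟨y, hy⟩
  obtain ⟨y, hy, hmin⟩ := hK.exists_isMinOn hne hg.norm
  refine ⟨y, hy, norm_eq_zero.1 (le_antisymm (le_of_forall_pos_le_add fun ε hε => ?_)
    (norm_nonneg _))⟩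
  obtain ⟨z, hz, hgz⟩ := hsmall (ε / 2) (half_pos hε)
  have : ‖g y‖ ≤ ‖g z‖ := hmin hz
  linarith

/-- A continuous map from a normed space to `ℝⁿ` identifies two antipodal points of each sphere
of a subspace of dimension greater than `n`. -/
theorem exists_eq_neg_of_continuous {F : Type*} [NormedAddCommGroup F] [NormedSpace ℝ F]
    (V : Submodule ℝ F) {n : ℕ} (hn : n < Module.finrank ℝ V) {N : F → Fin n → ℝ}
    (hN : Continuous N) {r : ℝ} (hr : 0 ≤ r) : ∃ f ∈ V, ‖f‖ = r ∧ N (-f) = N f := by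
  have : Module.Finite ℝ V := Module.finite_of_finrank_pos (by omega)
  obtain ⟨T, hT⟩ : ∃ T : (Fin (n + 1) → ℝ) →ₗ[ℝ] V, Function.Injective T :=
    finrank_le_iff_exists_linearMap.1 (by simpa using hn)
  let T' : (Fin (n + 1) → ℝ) →ₗ[ℝ] F := V.subtype ∘ₗ T
  have hT'0 : ∀ x, ∑ i, x i ^ 2 = 1 → ‖T' x‖ ≠ 0 := by
    intro x hx h
    have hx0 : x = 0 := by
      apply hT
      rw [map_zero]
      exact Subtype.ext (norm_eq_zero.1 h)
    simp [hx0] at hx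
  have hT'c : Continuous T' := T'.continuous_of_finiteDimensional
  let u : (Fin (n + 1) → ℝ) → F := fun x => (r / ‖T' x‖) • T' x
  have hu : ContinuousOn u {x | ∑ i, x i ^ 2 = 1} :=
    ((continuousOn_const).div hT'c.norm.continuousOn hT'0).smul hT'c.continuousOn
  have hneg : ∀ x, u (-x) = -u x := fun x => by simp [u]
  obtain ⟨y, hy, hgy⟩ := borsukUlam (fun x => N (u x) - N (-u x))
    ((hN.comp_continuousOn hu).sub (hN.comp_continuousOn hu.neg))
    (fun x _ => by simp only [hneg, neg_neg, neg_sub])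
  refine ⟨u y, V.smul_mem _ (T y).2, ?_, (sub_eq_zero.1 hgy).symm⟩
  rw [norm_smul, norm_div, norm_norm, Real.norm_of_nonneg hr, div_mul_cancel₀ _ (hT'0 y hy)]

theorem exists_eq_neg_of_isAdaptiveLinear {F : Type*} [NormedAddCommGroup F] [NormedSpace ℝ F]
    (V : Submodule ℝ F) {n : ℕ} (hn : n < Module.finrank ℝ V) {N : F → Fin n → ℝ}
    (hN : IsAdaptiveLinear N) {r : ℝ} (hr : 0 ≤ r) : ∃ f ∈ V, ‖f‖ = r ∧ N (-f) = N f := by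
  obtain ⟨L, hL⟩ := hN
  have : Module.Finite ℝ V := Module.finite_of_finrank_pos (by omega)
  let Λ : V →ₗ[ℝ] (Fin n → ℝ) := LinearMap.pi fun j => L j 0 ∘ₗ V.subtype
  have hker : LinearMap.ker Λ ≠ ⊥ := LinearMap.ker_ne_bot_of_finrank_lt (by simpa using hn)
  obtain ⟨v, hv, hv0⟩ := Submodule.exists_mem_ne_zero_of_ne_bot hker
  have hzero : ∀ c : ℝ, N (c • (v : F)) = 0 := by
    intro c
    have hlin : ∀ j, L j 0 (c • (v : F)) = 0 := fun j => by
      have := congrFun (LinearMap.mem_ker.1 hv) j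
      rw [map_smul]
      change L j 0 (v : F) = 0 at this
      rw [this, smul_zero]
    have : ∀ k (hk : k < n), N (c • (v : F)) ⟨k, hk⟩ = 0 := by
      intro k
      induction k using Nat.strong_induction_on with
      | _ k ih =>
        intro hk
        rw [hL]
        convert hlin ⟨k, hk⟩ using 3
        exact funext fun i => ih i i.2 _
    exact funext fun j => this j j.2
  have hvn : ‖(v : F)‖ ≠ 0 := by simpa using hv0
  refine ⟨(r / ‖(v : F)‖) • (v : F), V.smul_mem _ v.2, ?_, ?_⟩
  · rw [norm_smul, norm_div, norm_norm, Real.norm_of_nonneg hr, div_mul_cancel₀ _ hvn]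
  · rw [← neg_smul, hzero, hzero]

end EvenPolynomials

/-- **Paper Proposition 2.2**: lower bound on linear subspaces.  If `S` is homogeneous,
`V ⊆ F` is an `s`-dimensional subspace on which `a‖f‖ ≤ ‖S f‖`, then every algorithm
`φ ∘ N` using `n < s` pieces of information (with `N` continuous or adaptive linear)
makes an error of at least `a·r` at some point of the ball of radius `r`; in particular
its worst case error on the unit ball is at least `a`. -/
theorem stmt1 {F G : Type*} [NormedAddCommGroup F] [NormedSpace ℝ F]
    [NormedAddCommGroup G] [NormedSpace ℝ G]
    (S : F → G) (hS : ∀ (α : ℝ) (f : F), S (α • f) = α • S f)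
    (V : Submodule ℝ F) (s : ℕ) (hs : 1 ≤ s) (hdim : Module.finrank ℝ V = s)
    (a : ℝ) (ha : 0 ≤ a) (hbound : ∀ f ∈ V, a * ‖f‖ ≤ ‖S f‖)
    (n : ℕ) (hn : n < s) (N : F → (Fin n → ℝ))
    (hN : Continuous N ∨ IsAdaptiveLinear N)
    (φ : (Fin n → ℝ) → G) (r : ℝ) (hr : 0 ≤ r) :
    (∃ f : F, ‖f‖ ≤ r ∧ a * r ≤ ‖S f - φ (N f)‖) ∧
    (∃ f : F, ‖f‖ ≤ 1 ∧ a ≤ ‖S f - φ (N f)‖) := by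
  have key : ∀ ρ : ℝ, 0 ≤ ρ → ∃ f : F, ‖f‖ ≤ ρ ∧ a * ρ ≤ ‖S f - φ (N f)‖ := by
    intro ρ hρ
    obtain ⟨f, hfV, hfn, hNf⟩ : ∃ f ∈ V, ‖f‖ = ρ ∧ N (-f) = N f := by
      rcases hN with hN | hN
      · exact exists_eq_neg_of_continuous V (hdim ▸ hn) hN hρ
      · exact exists_eq_neg_of_isAdaptiveLinear V (hdim ▸ hn) hN hρ
    by_contra! h
    have h1 := h f hfn.le
    have h2 := h (-f) (by rw [norm_neg, hfn])
    have hSneg : S (-f) = -S f := by simpa using hS (-1) f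
    rw [hSneg, hNf] at h2
    have h3 := hbound f hfV
    rw [hfn] at h3
    have h4 : ‖(2 : ℝ) • S f‖ ≤ ‖S f - φ (N f)‖ + ‖-S f - φ (N f)‖ := by
      have : (2 : ℝ) • S f = (S f - φ (N f)) - (-S f - φ (N f)) := by rw [two_smul]; abel
      rw [this]
      exact norm_sub_le _ _
    rw [norm_smul, Real.norm_ofNat] at h4
    linarith
  exact ⟨key r hr, by simpa using key 1 zero_le_one⟩
end

section
/- Let λ = (λ_m)_{m≥1} be a non-increasing sequence of nonnegative reals with λ₂ > 0 and let (s_d)_{d≥1} be positive reals; set ε_d^init = √(s_d·λ₁^d). Consider the scaled tensor product problem with information complexity n(ε,d) = #{ j ∈ (ℕ_{≥1})^d : s_d·λ_{j₁}⋯λ_{j_d} > ε² }. Then: (a) if there exist c > 0 and infinitely many d with ε_d^init ≥ e^{c·d} (i.e. ln(ε_d^init) ∉ o(d)), the problem suffers from the curse of dimensionality; (b) if there exist α ≥ 0 and constants c₁, c₂ > 0 with c₁·d^α ≤ ε_d^init ≤ c₂·d^α for all d, then: if λ₁ = λ₂ the curse of dimensionality holds, while if λ₁ > λ₂ the problem is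 weakly tractable if and only if λ_n·(ln n)^{2(1+α)} → 0 as n → ∞; (c) if ε_d^init → 0 as d → ∞, the curse of dimensionality never holds, and the problem is weakly tractable if and only if either (i) λ₁ = λ₂, λ_n·(ln n)² → 0 as n → ∞, and d·ε_d^init → 0 as d → ∞, or (ii) λ₁ > λ₂ and λ_n·(ln n)² → 0 as n → ∞. -/
open scoped ENNReal
open Filter

/-- The set counted by the information complexity (absolute error criterion) of the
scaled tensor product problem: `{ j ∈ (ℕ_{≥1})^d : s_d · lam j₁ ⋯ lam j_d > ε² }`. -/
def AdmissibleSet (lam : ℕ → ℝ) (s : ℕ → ℝ) (ε : ℝ) (d : ℕ) : Set (Fin d → ℕ) :=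
  {j | (∀ k, 1 ≤ j k) ∧ ε ^ 2 < s d * ∏ k, lam (j k)}

/-- The initial error `ε_d^init = √(s_d · λ₁^d)` of the scaled problem. -/
noncomputable def epsInit (lam : ℕ → ℝ) (s : ℕ → ℝ) (d : ℕ) : ℝ :=
  Real.sqrt (s d * lam 1 ^ d)

/-- The curse of dimensionality: for some `ε > 0` the information complexity is at
least `C (1+γ)^d` for infinitely many `d`. -/
def SuffersCurse (lam : ℕ → ℝ) (s : ℕ → ℝ) : Prop :=
  ∃ ε > (0 : ℝ), ∃ C > (0 : ℝ), ∃ γ > (0 : ℝ), ∀ D : ℕ, ∃ d : ℕ, D ≤ d ∧ 1 ≤ d ∧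
    ENNReal.ofReal (C * (1 + γ) ^ d) ≤ ((AdmissibleSet lam s ε d).encard : ℝ≥0∞)

/-- Weak tractability: the information complexity is finite and
`ln n(ε,d) / (ε⁻¹ + d) → 0` along every admissible sequence `(ε_k, d_k)` with
`ε_k ∈ (0, ε_{d_k}^init)` and `ε_k⁻¹ + d_k → ∞`. -/
def WeaklyTractable (lam : ℕ → ℝ) (s : ℕ → ℝ) : Prop :=
  (∀ (d : ℕ) (ε : ℝ), 1 ≤ d → 0 < ε → ε < epsInit lam s d →
    (AdmissibleSet lam s ε d).Finite) ∧
  ∀ (εs : ℕ → ℝ) (ds : ℕ → ℕ),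
    (∀ k, 0 < εs k ∧ εs k < epsInit lam s (ds k)) →
    Tendsto (fun k => (εs k)⁻¹ + (ds k : ℝ)) atTop atTop →
    Tendsto (fun k =>
        Real.log (max ((AdmissibleSet lam s (εs k) (ds k)).ncard : ℝ) 1) /
          ((εs k)⁻¹ + (ds k : ℝ))) atTop (nhds 0)

section Counting

variable {d : ℕ} {nu : ℕ → ℝ}

/-- Functions `Fin d → {1, …, M}` with at most `a` values exceeding `p`. -/
def sparseFunctions (d p M a : ℕ) : Finset (Fin d → ℕ) :=
  (Fintype.piFinset fun _ => Finset.Icc 1 M).filter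
    fun f => (Finset.univ.filter fun k => p < f k).card ≤ a

theorem card_sparseFunctions_le (hd : 1 ≤ d) {p M : ℕ} (hp : 1 ≤ p) (hM : 1 ≤ M) (a : ℕ) :
    (sparseFunctions d p M a).card ≤ p ^ d * (d * M) ^ a := by
  induction a with
  | zero =>
    have hsub : sparseFunctions d p M 0 ⊆ Fintype.piFinset fun _ => Finset.Icc 1 p := by
      intro f hf
      simp only [sparseFunctions, Finset.mem_filter, Fintype.mem_piFinset, Finset.mem_Icc,
        Nat.le_zero, Finset.card_eq_zero, Finset.filter_eq_empty_iff, Finset.mem_univ,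
        true_implies, not_lt] at hf ⊢
      exact fun k => ⟨(hf.1 k).1, @hf.2 k⟩
    simpa using Finset.card_le_card hsub
  | succ a ih =>
    have hsub : sparseFunctions d p M (a + 1) ⊆
        (sparseFunctions d p M a ×ˢ (Finset.univ : Finset (Fin d)) ×ˢ Finset.Icc 1 M).image
          fun x => Function.update x.1 x.2.1 x.2.2 := by
      intro f hf
      simp only [sparseFunctions, Finset.mem_filter, Fintype.mem_piFinset, Finset.mem_Icc] at hf
      obtain ⟨hf1, hf2⟩ := hf
      simp only [Finset.mem_image, Finset.mem_product, Finset.mem_univ, true_and, Finset.mem_Icc,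
        Prod.exists]
      obtain ⟨k, hk⟩ : ∃ k, (Finset.univ.filter fun i => p < Function.update f k 1 i).card ≤ a := by
        by_cases h : ∃ k, p < f k
        · obtain ⟨k, hk⟩ := h
          refine ⟨k, ?_⟩
          have hlt : (Finset.univ.filter fun i => p < Function.update f k 1 i) ⊂
              (Finset.univ.filter fun i => p < f i) := by
            refine Finset.ssubset_iff_of_subset ?_ |>.2 ⟨k, by simpa using hk, by simp; omega⟩
            intro i hi
            by_cases hik : i = k
            · subst hik; simpa using hk
            · simpa [Function.update_of_ne hik] using hi
          have := Finset.card_lt_card hlt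
          omega
        · push Not at h
          refine ⟨⟨0, hd⟩, ?_⟩
          rw [Finset.filter_false_of_mem]
          · simp
          · intro i _
            by_cases hik : i = ⟨0, hd⟩
            · subst hik; simp; omega
            · simpa [Function.update_of_ne hik] using h i
      refine ⟨Function.update f k 1, k, f k, ⟨?_, hf1 k⟩, by simp⟩
      simp only [sparseFunctions, Finset.mem_filter, Fintype.mem_piFinset, Finset.mem_Icc]
      refine ⟨fun i => ?_, hk⟩
      by_cases hik : i = k
      · subst hik; simpa using hM
      · simpa [Function.update_of_ne hik] using hf1 i
    calc _ ≤ _ := Finset.card_le_card hsub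
      _ ≤ _ := Finset.card_image_le
      _ = (sparseFunctions d p M a).card * (d * M) := by simp
      _ ≤ p ^ d * (d * M) ^ a * (d * M) := Nat.mul_le_mul_right _ ih
      _ = _ := by ring

theorem prod_univ_le_prod_of_le_one (h0 : ∀ m, 0 ≤ nu m) (h1 : ∀ m, 1 ≤ m → nu m ≤ 1)
    {j : Fin d → ℕ} (hj : ∀ k, 1 ≤ j k) (S : Finset (Fin d)) :
    ∏ k, nu (j k) ≤ ∏ k ∈ S, nu (j k) := by
  rw [← Finset.prod_sdiff (Finset.subset_univ S)]
  exact mul_le_of_le_one_left (Finset.prod_nonneg fun _ _ => h0 _)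
    (Finset.prod_le_one (fun _ _ => h0 _) fun k _ => h1 _ (hj k))

/-- Only one coordinate can have `nu (j k) ^ 2 ≤ h`, and at most `A` coordinates exceed `p`. -/
theorem exists_finset_superset_card_le (hd : 1 ≤ d) (h0 : ∀ m, 0 ≤ nu m)
    (h1 : ∀ m, 1 ≤ m → nu m ≤ 1) (hanti : ∀ m m' : ℕ, 1 ≤ m → m ≤ m' → nu m' ≤ nu m)
    {h ρ : ℝ} {p N M A : ℕ} (hp : 1 ≤ p) (hM1 : 1 ≤ M) (hρ0 : 0 ≤ ρ) (hρ1 : ρ ≤ 1)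
    (hρ : ∀ m, p < m → nu m ≤ ρ) (hA : ρ ^ (A + 1) ≤ h)
    (hN : ∀ m, 1 ≤ m → h < nu m → m ≤ N) (hM : ∀ m, 1 ≤ m → h < nu m ^ 2 → m ≤ M) :
    ∃ F : Finset (Fin d → ℕ), {j : Fin d → ℕ | (∀ k, 1 ≤ j k) ∧ h < ∏ k, nu (j k)} ⊆ F ∧
      F.card ≤ p ^ d * (d * M) ^ A * (d * N) := by
  refine ⟨(sparseFunctions d p M A ×ˢ (Finset.univ : Finset (Fin d)) ×ˢ Finset.Icc 1 N).image
    fun x => Function.update x.1 x.2.1 x.2.2, ?_, ?_⟩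
  · rintro j ⟨hj, hprod⟩
    have : Nonempty (Fin d) := ⟨⟨0, hd⟩⟩
    obtain ⟨k₀, hk₀⟩ := Finite.exists_max j
    simp only [Finset.coe_image, Set.mem_image, Finset.mem_coe, Finset.mem_product,
      Finset.mem_univ, true_and, Finset.mem_Icc, Prod.exists]
    refine ⟨Function.update j k₀ 1, k₀, j k₀, ⟨?_, hj k₀, ?_⟩, by simp⟩
    · simp only [sparseFunctions, Finset.mem_filter, Fintype.mem_piFinset, Finset.mem_Icc]
      constructor
      · intro k
        by_cases hk : k = k₀
        · subst hk; simpa using hM1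
        · rw [Function.update_of_ne hk]
          refine ⟨hj k, hM _ (hj k) (hprod.trans_le ?_)⟩
          calc _ ≤ _ := prod_univ_le_prod_of_le_one h0 h1 hj {k, k₀}
            _ = nu (j k) * nu (j k₀) := Finset.prod_pair hk
            _ ≤ nu (j k) * nu (j k) :=
              mul_le_mul_of_nonneg_left (hanti _ _ (hj k) (hk₀ k)) (h0 _)
            _ = _ := by ring
      · have hcard : (Finset.univ.filter fun k => p < j k).card ≤ A := by
          by_contra! hlt
          refine absurd hprod (not_lt.2 ?_)
          calc _ ≤ _ := prod_univ_le_prod_of_le_one h0 h1 hj (Finset.univ.filter fun k => p < j k)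
            _ ≤ ∏ k ∈ Finset.univ.filter (fun k => p < j k), ρ :=
              Finset.prod_le_prod (fun _ _ => h0 _) fun k hk => hρ _ (by simpa using hk)
            _ = ρ ^ (Finset.univ.filter fun k => p < j k).card := Finset.prod_const _
            _ ≤ ρ ^ (A + 1) := pow_le_pow_of_le_one hρ0 hρ1 hlt
            _ ≤ h := hA
        refine (Finset.card_le_card ?_).trans hcard
        intro i hi
        by_cases hik : i = k₀
        · subst hik; simp at hi; omega
        · simpa [Function.update_of_ne hik] using hi
    · refine hN _ (hj k₀) (hprod.trans_le ?_)
      simpa using prod_univ_le_prod_of_le_one h0 h1 hj {k₀}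
  · calc _ ≤ _ := Finset.card_image_le
      _ = (sparseFunctions d p M A).card * (d * N) := by simp
      _ ≤ _ := Nat.mul_le_mul_right _ (card_sparseFunctions_le hd hp hM1 A)

end Counting

section Basic

variable {lam s : ℕ → ℝ}

theorem prod_le_encard_admissibleSet (hnn : ∀ m, 0 ≤ lam m)
    (hord : ∀ m m' : ℕ, 1 ≤ m → m ≤ m' → lam m' ≤ lam m) (hs : ∀ d, 0 < s d)
    {d : ℕ} {ε : ℝ} {b : Fin d → ℕ} (hb : ε ^ 2 < s d * ∏ k, lam (b k)) :
    ((∏ k, b k : ℕ) : ℕ∞) ≤ (AdmissibleSet lam s ε d).encard := by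
  have hsub : ((Fintype.piFinset fun k => Finset.Icc 1 (b k) : Finset (Fin d → ℕ)) :
      Set (Fin d → ℕ)) ⊆ AdmissibleSet lam s ε d := by
    intro j hj
    simp only [Finset.mem_coe, Fintype.mem_piFinset, Finset.mem_Icc] at hj
    refine ⟨fun k => (hj k).1, hb.trans_le ?_⟩
    exact mul_le_mul_of_nonneg_left
      (Finset.prod_le_prod (fun _ _ => hnn _) fun k _ => hord _ _ (hj k).1 (hj k).2) (hs d).le
  have h := Set.encard_le_encard hsub
  rwa [Set.encard_coe_eq_coe_finsetCard, Fintype.card_piFinset,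
    Finset.prod_congr rfl fun k _ => Nat.card_Icc 1 (b k)] at h

theorem epsInit_sq (hl1 : 0 ≤ lam 1) (hs : ∀ d, 0 < s d) (d : ℕ) :
    epsInit lam s d ^ 2 = s d * lam 1 ^ d :=
  Real.sq_sqrt (mul_nonneg (hs d).le (pow_nonneg hl1 d))

theorem epsInit_pos (hl1 : 0 < lam 1) (hs : ∀ d, 0 < s d) (d : ℕ) : 0 < epsInit lam s d :=
  Real.sqrt_pos.2 (mul_pos (hs d) (pow_pos hl1 d))

theorem prod_le_pow_one (hnn : ∀ m, 0 ≤ lam m)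
    (hord : ∀ m m' : ℕ, 1 ≤ m → m ≤ m' → lam m' ≤ lam m) {d : ℕ} {b : Fin d → ℕ}
    (hb : ∀ k, 1 ≤ b k) : ∏ k, lam (b k) ≤ lam 1 ^ d := by
  simpa using Finset.prod_le_prod (s := Finset.univ) (fun k _ => hnn (b k))
    fun k _ => hord 1 (b k) le_rfl (hb k)

/-- Letting the first `m` coordinates range over `{1, 2}` gives `2 ^ m` admissible indices. -/
theorem two_pow_le_encard_admissibleSet (hnn : ∀ m, 0 ≤ lam m)
    (hord : ∀ m m' : ℕ, 1 ≤ m → m ≤ m' → lam m' ≤ lam m) (hs : ∀ d, 0 < s d)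
    {d m : ℕ} (hm : m ≤ d) {ε : ℝ} (h : ε ^ 2 < s d * (lam 2 ^ m * lam 1 ^ (d - m))) :
    ((2 ^ m : ℕ) : ℕ∞) ≤ (AdmissibleSet lam s ε d).encard := by
  have hc : (Finset.univ.filter fun k : Fin d => (k : ℕ) < m).card = m := by
    rw [Fin.card_filter_val_lt, min_eq_right hm]
  have hc' : (Finset.univ.filter fun k : Fin d => ¬ (k : ℕ) < m).card = d - m := by
    have := Finset.card_filter_add_card_filter_not (s := (Finset.univ : Finset (Fin d)))
      (fun k : Fin d => (k : ℕ) < m)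
    rw [hc, Finset.card_univ, Fintype.card_fin] at this
    omega
  have h2 : ∏ k : Fin d, (if (k : ℕ) < m then 2 else 1) = 2 ^ m := by
    rw [Finset.prod_ite, Finset.prod_const, hc]; simp
  rw [← h2]
  refine prod_le_encard_admissibleSet hnn hord hs (h.trans_eq ?_)
  congr 1
  simp only [apply_ite lam]
  rw [Finset.prod_ite, Finset.prod_const, Finset.prod_const, hc, hc']

theorem suffersCurse_of_two_pow_le {ε δ : ℝ} (hε : 0 < ε) (hδ : 0 < δ)
    (h : ∀ D : ℕ, ∃ d : ℕ, D ≤ d ∧ 1 ≤ d ∧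
      ((2 ^ ⌊δ * d⌋₊ : ℕ) : ℕ∞) ≤ (AdmissibleSet lam s ε d).encard) :
    SuffersCurse lam s := by
  have hγ : 1 < (2 : ℝ) ^ δ := Real.one_lt_rpow one_lt_two hδ
  refine ⟨ε, hε, 1 / 2, by norm_num, (2 : ℝ) ^ δ - 1, by linarith, fun D => ?_⟩
  obtain ⟨d, hD, hd, hle⟩ := h D
  refine ⟨d, hD, hd, ?_⟩
  have h1 : 1 / 2 * (1 + ((2 : ℝ) ^ δ - 1)) ^ d ≤ ((2 ^ ⌊δ * d⌋₊ : ℕ) : ℝ) := by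
    have h3 : (2 : ℝ) ^ (δ * d) ≤ (2 : ℝ) ^ ((⌊δ * d⌋₊ : ℝ) + 1) :=
      Real.rpow_le_rpow_of_exponent_le one_le_two (Nat.lt_floor_add_one _).le
    rw [Real.rpow_add two_pos, Real.rpow_one, Real.rpow_natCast, Real.rpow_mul two_pos.le,
      Real.rpow_natCast] at h3
    push_cast
    rw [add_sub_cancel]
    linarith
  calc _ ≤ ENNReal.ofReal ((2 ^ ⌊δ * d⌋₊ : ℕ) : ℝ) := ENNReal.ofReal_le_ofReal h1
    _ = (((2 ^ ⌊δ * d⌋₊ : ℕ) : ℕ∞) : ℝ≥0∞) := by rw [ENNReal.ofReal_natCast]; simp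
    _ ≤ _ := by exact_mod_cast hle

theorem weaklyTractable_iff : WeaklyTractable lam s ↔
    (∀ (d : ℕ) (ε : ℝ), 1 ≤ d → 0 < ε → ε < epsInit lam s d →
      (AdmissibleSet lam s ε d).Finite) ∧
    ∀ δ > (0 : ℝ), ∃ T : ℝ, ∀ (d : ℕ) (ε : ℝ), 1 ≤ d → 0 < ε → ε < epsInit lam s d →
      T ≤ ε⁻¹ + d →
      Real.log (max ((AdmissibleSet lam s ε d).ncard : ℝ) 1) ≤ δ * (ε⁻¹ + d) := by
  refine and_congr_right fun hfin => ⟨fun h δ hδ => ?_, fun h εs ds hε hT => ?_⟩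
  · by_contra! hcon
    choose ds εs hd hε hεi hT hlt using fun k : ℕ => hcon k
    have h0 := h εs ds (fun k => ⟨hε k, hεi k⟩)
      (tendsto_atTop_mono hT tendsto_natCast_atTop_atTop)
    obtain ⟨k, hk⟩ := (h0.eventually_lt_const hδ).exists
    have hpos : 0 < (εs k)⁻¹ + (ds k : ℝ) := by
      have := inv_pos.2 (hε k); positivity
    rw [div_lt_iff₀ hpos] at hk
    exact (hlt k).not_gt hk
  · have hpos : ∀ k, 0 < (εs k)⁻¹ + (ds k : ℝ) := fun k => by
      have := inv_pos.2 (hε k).1; positivity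
    rw [Metric.tendsto_atTop']
    intro δ hδ
    obtain ⟨T, hTδ⟩ := h (δ / 2) (half_pos hδ)
    obtain ⟨K, hK⟩ := eventually_atTop.1 (hT.eventually_ge_atTop T)
    refine ⟨K, fun k hk => ?_⟩
    have hlog : 0 ≤ Real.log (max ((AdmissibleSet lam s (εs k) (ds k)).ncard : ℝ) 1) :=
      Real.log_nonneg (le_max_right _ _)
    rw [Real.dist_eq, sub_zero, abs_of_nonneg (div_nonneg hlog (hpos k).le), div_lt_iff₀ (hpos k)]
    have hhalf : δ / 2 * ((εs k)⁻¹ + (ds k : ℝ)) < δ * ((εs k)⁻¹ + (ds k : ℝ)) :=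
      mul_lt_mul_of_pos_right (half_lt_self hδ) (hpos k)
    rcases Nat.eq_zero_or_pos (ds k) with h0 | hd
    · have hle : (AdmissibleSet lam s (εs k) (ds k)).ncard ≤ 1 := by
        rw [h0]
        exact Set.ncard_le_one_of_subsingleton _
      have : max ((AdmissibleSet lam s (εs k) (ds k)).ncard : ℝ) 1 = 1 :=
        max_eq_right (by exact_mod_cast hle)
      rw [this, Real.log_one]
      exact mul_pos hδ (hpos k)
    · exact (hTδ _ _ hd (hε k).1 (hε k).2 (hK k hk.le)).trans_lt hhalf

theorem WeaklyTractable.log_prod_le (hnn : ∀ m, 0 ≤ lam m)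
    (hord : ∀ m m' : ℕ, 1 ≤ m → m ≤ m' → lam m' ≤ lam m) (hs : ∀ d, 0 < s d)
    (hW : WeaklyTractable lam s) {δ : ℝ} (hδ : 0 < δ) :
    ∃ T : ℝ, ∀ (d : ℕ) (ε : ℝ) (b : Fin d → ℕ), 1 ≤ d → 0 < ε → (∀ k, 1 ≤ b k) →
      ε ^ 2 < s d * ∏ k, lam (b k) → T ≤ ε⁻¹ + d →
      Real.log ((∏ k, b k : ℕ) : ℝ) ≤ δ * (ε⁻¹ + d) := by
  obtain ⟨hfin, hlog⟩ := weaklyTractable_iff.1 hW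
  obtain ⟨T, hT⟩ := hlog δ hδ
  refine ⟨T, fun d ε b hd hε hb1 hb hTd => ?_⟩
  have hεi : ε < epsInit lam s d :=
    Real.lt_sqrt_of_sq_lt (hb.trans_le (mul_le_mul_of_nonneg_left
      (prod_le_pow_one hnn hord hb1) (hs d).le))
  refine le_trans (Real.log_le_log ?_ ?_) (hT d ε hd hε hεi hTd)
  · exact_mod_cast Finset.prod_pos fun k _ => hb1 k
  · refine le_max_of_le_left ?_
    have h := prod_le_encard_admissibleSet hnn hord hs hb
    rw [← (hfin d ε hd hε hεi).cast_ncard_eq] at h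
    exact_mod_cast h

end Basic

section Curse

variable {lam s : ℕ → ℝ}

theorem suffersCurse_of_exp_le (hnn : ∀ m, 0 ≤ lam m)
    (hord : ∀ m m' : ℕ, 1 ≤ m → m ≤ m' → lam m' ≤ lam m) (hlam2 : 0 < lam 2)
    (hs : ∀ d, 0 < s d) {c : ℝ} (hc : 0 < c)
    (h : ∀ D : ℕ, ∃ d : ℕ, D ≤ d ∧ Real.exp (c * d) ≤ epsInit lam s d) :
    SuffersCurse lam s := by
  have h12 : lam 2 ≤ lam 1 := hord 1 2 le_rfl one_le_two
  have hl1 : 0 < lam 1 := hlam2.trans_le h12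
  set L := Real.log (lam 1 / lam 2) with hL
  have hL0 : 0 ≤ L := Real.log_nonneg ((one_le_div hlam2).2 h12)
  have hδ : 0 < min 1 (c / (L + 1)) := lt_min one_pos (by positivity)
  refine suffersCurse_of_two_pow_le (ε := 1 / 2) (by norm_num) hδ fun D => ?_
  obtain ⟨d, hd, hexp⟩ := h (max D 1)
  refine ⟨d, (le_max_left _ _).trans hd, (le_max_right _ _).trans hd, ?_⟩
  set m := ⌊min 1 (c / (L + 1)) * (d : ℝ)⌋₊
  have hm : (m : ℝ) ≤ min 1 (c / (L + 1)) * d := Nat.floor_le (by positivity)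
  have hmd : m ≤ d := by
    have : (m : ℝ) ≤ d :=
      hm.trans (mul_le_of_le_one_left (Nat.cast_nonneg d) (min_le_left _ _))
    exact_mod_cast this
  have hmL : m * L ≤ c * d := by
    have h1 : (m : ℝ) ≤ c / (L + 1) * d :=
      hm.trans (mul_le_mul_of_nonneg_right (min_le_right _ _) (Nat.cast_nonneg d))
    calc (m : ℝ) * L ≤ c / (L + 1) * d * (L + 1) := by gcongr; linarith
      _ = c * d := by field_simp
  refine two_pow_le_encard_admissibleSet hnn hord hs hmd ?_
  have hexpL : Real.exp L = lam 1 / lam 2 := Real.exp_log (by positivity)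
  have hpow : lam 1 ^ m = Real.exp (m * L) * lam 2 ^ m := by
    rw [Real.exp_nat_mul, hexpL, div_pow]; field_simp
  have h3 : Real.exp (c * d) ^ 2 ≤ s d * lam 1 ^ d := by
    rw [← epsInit_sq hl1.le hs]; gcongr
  have h4 : s d * lam 1 ^ d = Real.exp (m * L) * (s d * (lam 2 ^ m * lam 1 ^ (d - m))) := by
    have h9 : lam 1 ^ d = lam 1 ^ m * lam 1 ^ (d - m) := by
      rw [← pow_add, Nat.add_sub_cancel' hmd]
    rw [h9, hpow]; ring
  have h5 : Real.exp (m * L) ≤ Real.exp (c * d) := Real.exp_le_exp.2 hmL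
  have h6 : 1 ≤ Real.exp (c * d) := Real.one_le_exp (by positivity)
  have h7 : 0 < s d * (lam 2 ^ m * lam 1 ^ (d - m)) := by have := hs d; positivity
  rw [h4] at h3
  have h8 : Real.exp (c * d) ≤ s d * (lam 2 ^ m * lam 1 ^ (d - m)) := by
    have h9 := h3.trans (mul_le_mul_of_nonneg_right h5 h7.le)
    rw [sq] at h9
    exact le_of_mul_le_mul_left h9 (Real.exp_pos _)
  linarith

theorem suffersCurse_of_eq (hnn : ∀ m, 0 ≤ lam m)
    (hord : ∀ m m' : ℕ, 1 ≤ m → m ≤ m' → lam m' ≤ lam m) (hl1 : 0 < lam 1)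
    (hs : ∀ d, 0 < s d) (h12 : lam 1 = lam 2) {c : ℝ} (hc : 0 < c)
    (h : ∀ d : ℕ, 1 ≤ d → c ≤ epsInit lam s d) : SuffersCurse lam s := by
  refine suffersCurse_of_two_pow_le (half_pos hc) one_pos fun D => ?_
  refine ⟨D + 1, by omega, by omega, ?_⟩
  rw [one_mul, Nat.floor_natCast]
  refine two_pow_le_encard_admissibleSet hnn hord hs le_rfl ?_
  rw [Nat.sub_self, pow_zero, mul_one, ← h12, ← epsInit_sq hl1.le hs]
  exact pow_lt_pow_left₀ ((half_lt_self hc).trans_le (h _ (by omega))) (by positivity) two_ne_zero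

theorem not_suffersCurse_of_tendsto_zero (hnn : ∀ m, 0 ≤ lam m)
    (hord : ∀ m m' : ℕ, 1 ≤ m → m ≤ m' → lam m' ≤ lam m) (hs : ∀ d, 0 < s d)
    (h : Tendsto (fun d : ℕ => epsInit lam s d) atTop (nhds 0)) : ¬ SuffersCurse lam s := by
  rintro ⟨ε, hε, C, hC, γ, hγ, hcurse⟩
  obtain ⟨D, hD⟩ := eventually_atTop.1 (h.eventually_lt_const hε)
  obtain ⟨d, hd, -, hle⟩ := hcurse D
  have hempty : AdmissibleSet lam s ε d = ∅ := by
    refine Set.eq_empty_of_forall_notMem fun j hj => ?_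
    refine (hD d hd).not_gt (Real.lt_sqrt_of_sq_lt (hj.2.trans_le ?_))
    exact mul_le_mul_of_nonneg_left (prod_le_pow_one hnn hord hj.1) (hs d).le
  rw [hempty, Set.encard_empty] at hle
  have hpos : 0 < ENNReal.ofReal (C * (1 + γ) ^ d) := ENNReal.ofReal_pos.2 (by positivity)
  exact absurd hle (by simpa using hpos)

end Curse

section Necessity

variable {lam s : ℕ → ℝ}

theorem WeaklyTractable.exists_lt (hnn : ∀ m, 0 ≤ lam m)
    (hord : ∀ m m' : ℕ, 1 ≤ m → m ≤ m' → lam m' ≤ lam m) (hs : ∀ d, 0 < s d)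
    (hW : WeaklyTractable lam s) {η : ℝ} (hη : 0 < η) : ∃ m, 1 ≤ m ∧ lam m < η := by
  by_contra! hcon
  have hs1 := hs 1
  set ε := Real.sqrt (s 1 * η / 2) with hε
  have hεpos : 0 < ε := Real.sqrt_pos.2 (by positivity)
  have hεsq : ε ^ 2 = s 1 * η / 2 := Real.sq_sqrt (by positivity)
  have hlt : ∀ n, 1 ≤ n → ε ^ 2 < s 1 * lam n := fun n hn => by
    have := mul_le_mul_of_nonneg_left (hcon n hn) hs1.le
    have : 0 < s 1 * η := by positivity
    linarith
  have hfin := hW.1 1 ε le_rfl hεpos (Real.lt_sqrt_of_sq_lt (by simpa using hlt 1 le_rfl))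
  have hle := prod_le_encard_admissibleSet hnn hord hs (ε := ε) (d := 1)
    (b := fun _ => (AdmissibleSet lam s ε 1).ncard + 1) (by simpa using hlt _ (by omega))
  rw [← hfin.cast_ncard_eq] at hle
  have : (AdmissibleSet lam s ε 1).ncard + 1 ≤ (AdmissibleSet lam s ε 1).ncard := by
    simpa using (Nat.cast_le (α := ℕ∞)).1 hle
  omega

theorem WeaklyTractable.tendsto_mul_log_sq (hnn : ∀ m, 0 ≤ lam m)
    (hord : ∀ m m' : ℕ, 1 ≤ m → m ≤ m' → lam m' ≤ lam m)
    (hs : ∀ d, 0 < s d) (hW : WeaklyTractable lam s) :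
    Tendsto (fun m : ℕ => lam m * Real.log m ^ 2) atTop (nhds 0) := by
  have hs1 := hs 1
  rw [Metric.tendsto_atTop']
  intro η hη
  set B := 2 / Real.sqrt (s 1) + 1 with hB
  have hBpos : 0 < B := by positivity
  obtain ⟨T, hT⟩ := hW.log_prod_le hnn hord hs (δ := Real.sqrt (η / 2) / B) (by positivity)
  obtain ⟨m₀, hm₀, hsmall⟩ := hW.exists_lt hnn hord hs
    (η := min 1 (4 / (s 1 * (|T| + 1) ^ 2))) (lt_min one_pos (by positivity))
  refine ⟨m₀, fun m hm => ?_⟩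
  have hm1 : 1 ≤ m := hm₀.trans hm.le
  rw [Real.dist_eq, sub_zero, abs_of_nonneg (mul_nonneg (hnn m) (sq_nonneg _))]
  rcases (hnn m).eq_or_lt with h0 | hpos
  · rw [← h0, zero_mul]; exact hη
  have hlam := (hord m₀ m hm₀ hm.le).trans_lt hsmall
  set ε := Real.sqrt (s 1) * Real.sqrt (lam m) / 2 with hε
  have hεpos : 0 < ε := by positivity
  have hεsq : ε ^ 2 = s 1 * lam m / 4 := by
    rw [hε, div_pow, mul_pow, Real.sq_sqrt hs1.le, Real.sq_sqrt hpos.le]; norm_num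
  have hsl : 0 < s 1 * lam m := by positivity
  have hTε : T ≤ ε⁻¹ := by
    refine (le_abs_self T).trans ((le_add_of_nonneg_right zero_le_one).trans ?_)
    rw [le_inv_comm₀ (by positivity) hεpos]
    refine le_of_sq_le_sq ?_ (by positivity)
    have h1 := (hlam.trans_le (min_le_right _ _)).le
    rw [le_div_iff₀ (by positivity)] at h1
    rw [hεsq, inv_pow, ← one_div, le_div_iff₀ (by positivity)]
    linarith
  have hlog := hT 1 ε (fun _ => m) le_rfl hεpos (fun _ => hm1)
    (by rw [hεsq]; simp; linarith) (by push_cast; linarith)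
  simp only [Finset.univ_unique, Finset.prod_const, Finset.card_singleton, pow_one,
    Nat.cast_one] at hlog
  have hsq1 : Real.sqrt (lam m) ≤ 1 := Real.sqrt_le_one.2 (hlam.le.trans (min_le_left _ _))
  have h2 : Real.sqrt (lam m) * Real.log m ≤ Real.sqrt (η / 2) := by
    calc _ ≤ Real.sqrt (lam m) * (Real.sqrt (η / 2) / B * (ε⁻¹ + 1)) := by gcongr
      _ = Real.sqrt (η / 2) / B * (2 / Real.sqrt (s 1) + Real.sqrt (lam m)) := by
        rw [hε]; field_simp
      _ ≤ Real.sqrt (η / 2) / B * B := by gcongr; linarith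
      _ = _ := by field_simp
  have h3 : lam m * Real.log m ^ 2 ≤ η / 2 := by
    have h4 : (Real.sqrt (lam m) * Real.log m) ^ 2 ≤ Real.sqrt (η / 2) ^ 2 :=
      pow_le_pow_left₀ (mul_nonneg (Real.sqrt_nonneg _) (Real.log_natCast_nonneg m)) h2 2
    rwa [mul_pow, Real.sq_sqrt hpos.le, Real.sq_sqrt (by positivity)] at h4
  linarith

theorem WeaklyTractable.tendsto_mul_epsInit (hnn : ∀ m, 0 ≤ lam m)
    (hord : ∀ m m' : ℕ, 1 ≤ m → m ≤ m' → lam m' ≤ lam m) (hl1 : 0 < lam 1)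
    (hs : ∀ d, 0 < s d) (h12 : lam 1 = lam 2) (hW : WeaklyTractable lam s) :
    Tendsto (fun d : ℕ => (d : ℝ) * epsInit lam s d) atTop (nhds 0) := by
  rw [Metric.tendsto_atTop']
  intro η hη
  obtain ⟨T, hT⟩ := hW.log_prod_le hnn hord hs (δ := min (1 / 4) (η / 16))
    (lt_min (by norm_num) (by positivity))
  refine ⟨max ⌈T⌉₊ 1, fun d hd => ?_⟩
  have hd1 : 1 ≤ d := (le_max_right _ _).trans hd.le
  have hTd : T ≤ d := (Nat.le_ceil T).trans (by exact_mod_cast (le_max_left _ _).trans hd.le)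
  have he := epsInit_pos hl1 hs d
  rw [Real.dist_eq, sub_zero, abs_of_nonneg (by positivity)]
  have hlog := hT d (epsInit lam s d / 2) (fun _ => 2) hd1 (half_pos he) (fun _ => one_le_two)
    (by
      simp only [Finset.prod_const, Finset.card_univ, Fintype.card_fin]
      rw [← h12, ← epsInit_sq hl1.le hs]
      exact pow_lt_pow_left₀ (half_lt_self he) (half_pos he).le two_ne_zero)
    (by have := inv_pos.2 (half_pos he); linarith)
  simp only [Finset.prod_const, Finset.card_univ, Fintype.card_fin, Nat.cast_pow, Real.log_pow,
    Nat.cast_ofNat] at hlog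
  have hl2 : (1 : ℝ) / 2 < Real.log 2 := by have := Real.log_two_gt_d9; linarith
  have hd0 : (0 : ℝ) < d := by exact_mod_cast hd1
  have h1 : (d : ℝ) * (1 / 2) ≤ η / 16 * (epsInit lam s d / 2)⁻¹ + 1 / 4 * d := by
    calc (d : ℝ) * (1 / 2) ≤ d * Real.log 2 := by gcongr
      _ ≤ _ := hlog
      _ = min (1 / 4) (η / 16) * (epsInit lam s d / 2)⁻¹ + min (1 / 4) (η / 16) * d := by ring
      _ ≤ _ := by
        gcongr
        · exact min_le_right _ _
        · exact min_le_left _ _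
  have h2 : (d : ℝ) / 4 * epsInit lam s d ≤ η / 16 * (epsInit lam s d / 2)⁻¹ * epsInit lam s d :=
    mul_le_mul_of_nonneg_right (by linarith) he.le
  have h3 : η / 16 * (epsInit lam s d / 2)⁻¹ * epsInit lam s d = η / 8 := by field_simp; norm_num
  rw [h3] at h2
  linarith

theorem WeaklyTractable.tendsto_mul_log_rpow (hnn : ∀ m, 0 ≤ lam m)
    (hord : ∀ m m' : ℕ, 1 ≤ m → m ≤ m' → lam m' ≤ lam m) (hl1 : 0 < lam 1)
    (hs : ∀ d, 0 < s d) {α c : ℝ} (hα : 0 ≤ α) (hc : 0 < c)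
    (h : ∀ d : ℕ, 1 ≤ d → c * (d : ℝ) ^ α ≤ epsInit lam s d) (hW : WeaklyTractable lam s) :
    Tendsto (fun m : ℕ => lam m * Real.log m ^ (2 * (1 + α))) atTop (nhds 0) := by
  rw [Metric.tendsto_atTop']
  intro η hη
  set δ := min (1 / 4) (c / 4 * Real.sqrt (η / 2 / lam 1)) with hδ
  have hδpos : 0 < δ := lt_min (by norm_num) (by positivity)
  obtain ⟨T, hT⟩ := hW.log_prod_le hnn hord hs hδpos
  obtain ⟨m₀, hm₀⟩ := eventually_atTop.1
    ((Real.tendsto_log_atTop.comp tendsto_natCast_atTop_atTop).eventually_ge_atTop (max T 1))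
  refine ⟨max m₀ 1, fun m hm => ?_⟩
  have hm1 : 1 ≤ m := (le_max_right _ _).trans hm.le
  have hlogm : max T 1 ≤ Real.log m := hm₀ m ((le_max_left _ _).trans hm.le)
  have hlog1 : 1 ≤ Real.log m := (le_max_right _ _).trans hlogm
  have hlog0 : 0 < Real.log m := one_pos.trans_le hlog1
  rw [Real.dist_eq, sub_zero,
    abs_of_nonneg (mul_nonneg (hnn m) (Real.rpow_nonneg hlog0.le _))]
  rcases (hnn m).eq_or_lt with h0 | hpos
  · rw [← h0, zero_mul]; exact hη
  set d := ⌈Real.log m⌉₊ with hd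
  have hlogd : Real.log m ≤ d := Nat.le_ceil _
  have hdlog : (d : ℝ) ≤ 2 * Real.log m := by
    have := Nat.ceil_lt_add_one hlog0.le
    linarith
  have hd1 : 1 ≤ d := Nat.one_le_ceil_iff.2 hlog0
  have he := epsInit_pos hl1 hs d
  set r := Real.sqrt (lam m / lam 1) with hr
  have hrpos : 0 < r := Real.sqrt_pos.2 (by positivity)
  have hrsq : r ^ 2 = lam m / lam 1 := Real.sq_sqrt (by positivity)
  set ε := epsInit lam s d * r / 2 with hε
  have hεpos : 0 < ε := by positivity
  have hprod : ∏ k, lam (Function.update (fun _ : Fin d => 1) ⟨0, hd1⟩ m k) =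
      lam m * lam 1 ^ (d - 1) := by
    rw [← Finset.mul_prod_erase _ _ (Finset.mem_univ (⟨0, hd1⟩ : Fin d)), Function.update_self,
      Finset.prod_congr rfl (g := fun _ => lam 1)]
    · rw [Finset.prod_const, Finset.card_erase_of_mem (Finset.mem_univ _), Finset.card_univ,
        Fintype.card_fin]
    · intro k hk
      rw [Function.update_of_ne (Finset.ne_of_mem_erase hk)]
  have hprodb : ∏ k, Function.update (fun _ : Fin d => 1) ⟨0, hd1⟩ m k = m := by
    rw [Finset.prod_update_of_mem (Finset.mem_univ _)]; simp
  have hlt : ε ^ 2 < s d * (lam m * lam 1 ^ (d - 1)) := by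
    have h1 : ε ^ 2 = s d * (lam m * lam 1 ^ (d - 1)) / 4 := by
      have h2 : lam 1 ^ d = lam 1 ^ (d - 1) * lam 1 := by
        rw [← pow_succ, Nat.sub_add_cancel hd1]
      rw [hε, div_pow, mul_pow, hrsq, epsInit_sq hl1.le hs, h2]
      field_simp
      norm_num
    have := hs d
    have : 0 < s d * (lam m * lam 1 ^ (d - 1)) := by positivity
    linarith
  have hlog := hT d ε (Function.update (fun _ => 1) ⟨0, hd1⟩ m) hd1 hεpos
    (fun k => by
      by_cases hk : k = ⟨0, hd1⟩
      · subst hk; simpa using hm1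
      · rw [Function.update_of_ne hk])
    (by rwa [hprod])
    (by
      have := inv_pos.2 hεpos
      have := (le_max_left T 1).trans hlogm
      linarith)
  rw [hprodb] at hlog
  have h1 : Real.log m / 2 ≤ δ * ε⁻¹ := by
    have : δ * d ≤ 1 / 4 * (2 * Real.log m) :=
      mul_le_mul (min_le_left _ _) hdlog (Nat.cast_nonneg d) (by norm_num)
    linarith
  have h2 : Real.log m * (c * Real.log m ^ α * r) ≤ 4 * δ := by
    have h3 : c * Real.log m ^ α * r ≤ 2 * ε := by
      have : c * Real.log m ^ α ≤ epsInit lam s d :=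
        le_trans (by gcongr) (h d hd1)
      calc _ ≤ epsInit lam s d * r := by gcongr
        _ = 2 * ε := by rw [hε]; ring
    calc _ ≤ Real.log m * (2 * ε) := by gcongr
      _ = (Real.log m / 2) * (4 * ε) := by ring
      _ ≤ δ * ε⁻¹ * (4 * ε) := by gcongr
      _ = 4 * δ := by field_simp
  have h4 : Real.log m ^ (1 + α) * r ≤ Real.sqrt (η / 2 / lam 1) := by
    have h5 : δ ≤ c / 4 * Real.sqrt (η / 2 / lam 1) := min_le_right _ _
    rw [Real.rpow_add hlog0, Real.rpow_one]
    refine le_of_mul_le_mul_left ?_ hc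
    linarith
  have h6 : lam m * Real.log m ^ (2 * (1 + α)) ≤ η / 2 := by
    have h7 := pow_le_pow_left₀ (by positivity) h4 2
    rw [mul_pow, hrsq, Real.sq_sqrt (by positivity), ← Real.rpow_mul_natCast hlog0.le,
      ← mul_div_assoc, div_le_div_iff_of_pos_right hl1] at h7
    rw [mul_comm, mul_comm 2 (1 + α)]
    exact_mod_cast h7
  linarith

end Necessity

section Sufficiency

variable {lam s : ℕ → ℝ}

theorem exists_log_le_of_tendsto (hnn : ∀ m, 0 ≤ lam m) {α : ℝ} (hα : 0 ≤ α) (hl1 : 0 < lam 1)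
    (h : Tendsto (fun m : ℕ => lam m * Real.log m ^ (2 * (1 + α))) atTop (nhds 0))
    {δ : ℝ} (hδ : 0 < δ) :
    ∃ C : ℝ, 0 ≤ C ∧ ∀ (m : ℕ) (V : ℝ), 1 ≤ m → 0 ≤ V →
      lam 1 < lam m * V ^ (2 * (1 + α)) → Real.log m ≤ δ * V + C := by
  obtain ⟨m₀, hm₀⟩ := eventually_atTop.1
    (h.eventually_lt_const (u := lam 1 * δ ^ (2 * (1 + α))) (by positivity))
  refine ⟨Real.log (m₀ + 1 : ℕ), Real.log_natCast_nonneg _, fun m V hm hV hlt => ?_⟩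
  rcases le_total m₀ m with hle | hle
  · suffices Real.log m ≤ δ * V from
      this.trans (le_add_of_nonneg_right (Real.log_natCast_nonneg _))
    by_contra! hcon
    refine (hm₀ m hle).not_ge ?_
    calc lam 1 * δ ^ (2 * (1 + α)) ≤ lam m * V ^ (2 * (1 + α)) * δ ^ (2 * (1 + α)) := by gcongr
      _ = lam m * (δ * V) ^ (2 * (1 + α)) := by rw [Real.mul_rpow hδ.le hV]; ring
      _ ≤ lam m * Real.log m ^ (2 * (1 + α)) := by
        have := hnn m
        gcongr
  · have h1 : Real.log m ≤ Real.log (m₀ + 1 : ℕ) :=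
      Real.log_le_log (by exact_mod_cast hm) (by exact_mod_cast hle.trans (Nat.le_succ _))
    have := mul_nonneg hδ.le hV
    linarith

theorem finite_and_log_ncard_le (hnn : ∀ m, 0 ≤ lam m)
    (hord : ∀ m m' : ℕ, 1 ≤ m → m ≤ m' → lam m' ≤ lam m) (hl1 : 0 < lam 1)
    (hs : ∀ d, 0 < s d) {p : ℕ} (hp : 1 ≤ p) (hlamp : lam (p + 1) < lam 1)
    {α c : ℝ} (hα : 0 ≤ α) (hc : 1 ≤ c)
    (hinit : ∀ d : ℕ, 1 ≤ d → epsInit lam s d ≤ c * (d : ℝ) ^ α)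
    (h : Tendsto (fun m : ℕ => lam m * Real.log m ^ (2 * (1 + α))) atTop (nhds 0))
    {δ : ℝ} (hδ : 0 < δ) :
    ∃ K : ℝ, 0 ≤ K ∧ ∀ (d : ℕ) (ε W : ℝ), 1 ≤ d → 0 < ε → ε < epsInit lam s d → 1 ≤ W →
      W ^ 4 = c * (ε⁻¹ + d) → (AdmissibleSet lam s ε d).Finite ∧
      Real.log (max ((AdmissibleSet lam s ε d).ncard : ℝ) 1) ≤
        d * Real.log p + δ * W ^ 4 + K * W ^ 3 := by
  obtain ⟨C, hC0, hC⟩ := exists_log_le_of_tendsto hnn hα hl1 h hδ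
  obtain ⟨C₁, hC₁0, hC₁⟩ := exists_log_le_of_tendsto hnn hα hl1 h one_pos
  set ρ := max (lam (p + 1) / lam 1) (1 / 2) with hρ
  have hρ0 : 0 < ρ := lt_max_of_lt_right (by norm_num)
  have hρ1 : ρ < 1 := max_lt ((div_lt_one hl1).2 hlamp) (by norm_num)
  set L := -Real.log ρ with hL
  have hL0 : 0 < L := neg_pos.2 (Real.log_neg hρ0 hρ1)
  set K₀ := 8 * (1 + α) / L with hK₀
  have hK₀0 : 0 ≤ K₀ := by positivity
  refine ⟨K₀ * (5 + C₁) + 4 + C, by positivity, fun d ε W hd hε hεi hW hWU => ?_⟩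
  have hd0 : (1 : ℝ) ≤ d := by exact_mod_cast hd
  have hW0 : 0 < W := one_pos.trans_le hW
  have hεinv := inv_pos.2 hε
  set H := epsInit lam s d / ε with hH
  have hH1 : 1 < H := (one_lt_div hε).2 hεi
  have hH0 : 0 < H := one_pos.trans hH1
  have hTU : ε⁻¹ + d ≤ W ^ 4 := by
    rw [hWU]; exact le_mul_of_one_le_left (by positivity) hc
  have hHU : H ≤ (W ^ 4) ^ (1 + α) := by
    have hT : 0 < ε⁻¹ + d := by positivity
    calc H = epsInit lam s d * ε⁻¹ := div_eq_mul_inv _ _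
      _ ≤ c * (d : ℝ) ^ α * ε⁻¹ := by gcongr; exact hinit d hd
      _ ≤ c * (ε⁻¹ + d) ^ α * (ε⁻¹ + d) := by gcongr <;> linarith
      _ = c * (ε⁻¹ + d) ^ (1 + α) := by rw [Real.rpow_add hT, Real.rpow_one]; ring
      _ ≤ c ^ (1 + α) * (ε⁻¹ + d) ^ (1 + α) := by
        gcongr
        exact Real.self_le_rpow_of_one_le hc (by linarith)
      _ = _ := by rw [hWU, Real.mul_rpow (by linarith) hT.le]
  have hlogW : Real.log W ≤ W := (Real.log_le_sub_one_of_pos hW0).trans (by linarith)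
  have hlogW4 : Real.log (W ^ 4) ≤ 4 * W := by rw [Real.log_pow]; push_cast; linarith
  have hlogH : Real.log H ≤ (1 + α) * (4 * W) := by
    calc Real.log H ≤ Real.log ((W ^ 4) ^ (1 + α)) := Real.log_le_log hH0 hHU
      _ = (1 + α) * Real.log (W ^ 4) := Real.log_rpow (by positivity) _
      _ ≤ _ := by gcongr
  have hlogH0 : 0 ≤ Real.log H := Real.log_nonneg hH1.le
  have hlogd : Real.log d ≤ 4 * W :=
    (Real.log_le_log (by linarith) (by linarith)).trans hlogW4
  set A := ⌊2 * Real.log H / L⌋₊ with hA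
  have hAle : (A : ℝ) ≤ K₀ * W := by
    calc (A : ℝ) ≤ 2 * Real.log H / L := Nat.floor_le (by positivity)
      _ ≤ 2 * ((1 + α) * (4 * W)) / L := by gcongr
      _ = K₀ * W := by rw [hK₀]; ring
  set M := ⌊Real.exp (1 * W ^ 2 + C₁)⌋₊ with hM
  set N := ⌊Real.exp (δ * W ^ 4 + C)⌋₊ with hN
  have hM1 : 1 ≤ M := Nat.le_floor (by simpa using Real.one_le_exp (by positivity))
  have hN1 : 1 ≤ N := Nat.le_floor (by simpa using Real.one_le_exp (by positivity))
  have hset : AdmissibleSet lam s ε d =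
      {j : Fin d → ℕ | (∀ k, 1 ≤ j k) ∧ (H ^ 2)⁻¹ < ∏ k, lam (j k) / lam 1} := by
    ext j
    refine and_congr_right fun _ => ?_
    rw [Finset.prod_div_distrib, Finset.prod_const, Finset.card_univ, Fintype.card_fin, hH,
      div_pow, epsInit_sq hl1.le hs, inv_div, div_lt_div_iff₀ (by have := hs d; positivity)
      (by positivity), ← mul_assoc, mul_lt_mul_iff_left₀ (by positivity), mul_comm (s d)]
  obtain ⟨F, hF, hFcard⟩ := exists_finset_superset_card_le (d := d)
    (nu := fun m => lam m / lam 1) (h := (H ^ 2)⁻¹) (ρ := ρ) (p := p) (N := N) (M := M) (A := A)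
    hd (fun m => div_nonneg (hnn m) hl1.le)
    (fun m hm => (div_le_one hl1).2 (hord 1 m le_rfl hm))
    (fun m m' hm hmm => by have := hord m m' hm hmm; gcongr)
    hp hM1 hρ0.le hρ1.le
    (fun m hm => le_max_of_le_left (by have := hord (p + 1) m (by omega) hm; gcongr))
    (by
      have h1 : 2 * Real.log H < (A + 1) * L := (div_lt_iff₀ hL0).1 (Nat.lt_floor_add_one _)
      rw [← Real.log_le_log_iff (by positivity) (by positivity), Real.log_pow, Real.log_inv,
        Real.log_pow]
      push_cast
      linarith)
    (fun m hm hlt => by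
      refine Nat.le_floor ((Real.log_le_iff_le_exp (by exact_mod_cast hm)).1
        (hC m (W ^ 4) hm (by positivity) ?_))
      rw [inv_lt_iff_one_lt_mul₀ (by positivity), div_mul_eq_mul_div, one_lt_div hl1] at hlt
      refine hlt.trans_le (mul_le_mul_of_nonneg_left ?_ (hnn m))
      calc H ^ 2 ≤ ((W ^ 4) ^ (1 + α)) ^ 2 := by gcongr
        _ = _ := by rw [← Real.rpow_mul_natCast (by positivity), mul_comm]; norm_num)
    (fun m hm hlt => by
      refine Nat.le_floor ((Real.log_le_iff_le_exp (by exact_mod_cast hm)).1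
        (hC₁ m (W ^ 2) hm (by positivity) ?_))
      rw [← inv_pow] at hlt
      have hlt' := lt_of_pow_lt_pow_left₀ 2 (div_nonneg (hnn m) hl1.le) hlt
      rw [inv_lt_iff_one_lt_mul₀ (by positivity), div_mul_eq_mul_div, one_lt_div hl1] at hlt'
      refine hlt'.trans_le (mul_le_mul_of_nonneg_left ?_ (hnn m))
      calc H ≤ (W ^ 4) ^ (1 + α) := hHU
        _ = _ := by
          rw [Real.rpow_mul (by positivity), Real.rpow_two, ← pow_mul])
  rw [← hset] at hF
  refine ⟨F.finite_toSet.subset hF, ?_⟩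
  have hcard : (AdmissibleSet lam s ε d).ncard ≤ p ^ d * (d * M) ^ A * (d * N) := by
    have := Set.ncard_le_ncard hF F.finite_toSet
    rw [Set.ncard_coe_finset] at this
    exact this.trans hFcard
  have hone : 1 ≤ p ^ d * (d * M) ^ A * (d * N) := Nat.one_le_iff_ne_zero.2 (by positivity)
  have hlogM : Real.log M ≤ W ^ 2 + C₁ := by
    rw [Real.log_le_iff_le_exp (by exact_mod_cast hM1)]
    rw [hM, one_mul]
    exact Nat.floor_le (Real.exp_pos _).le
  have hlogN : Real.log N ≤ δ * W ^ 4 + C := by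
    rw [Real.log_le_iff_le_exp (by exact_mod_cast hN1)]
    exact Nat.floor_le (Real.exp_pos _).le
  have hd' : (d : ℝ) ≠ 0 := by positivity
  have hp' : (p : ℝ) ≠ 0 := by positivity
  have hM' : (M : ℝ) ≠ 0 := by positivity
  have hN' : (N : ℝ) ≠ 0 := by positivity
  have hWW : W ≤ W ^ 3 := le_self_pow₀ hW (by norm_num)
  have hWW2 : W ^ 2 ≤ W ^ 3 := pow_le_pow_right₀ hW (by norm_num)
  have hW3 : 1 ≤ W ^ 3 := one_le_pow₀ hW
  calc Real.log (max ((AdmissibleSet lam s ε d).ncard : ℝ) 1)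
      ≤ Real.log ((p ^ d * (d * M) ^ A * (d * N) : ℕ) : ℝ) :=
        Real.log_le_log (by positivity) (max_le (by exact_mod_cast hcard) (by exact_mod_cast hone))
    _ = d * Real.log p + A * (Real.log d + Real.log M) + (Real.log d + Real.log N) := by
        push_cast
        rw [Real.log_mul (by positivity) (by positivity),
          Real.log_mul (by positivity) (by positivity), Real.log_mul hd' hN', Real.log_pow,
          Real.log_pow, Real.log_mul hd' hM']
    _ ≤ d * Real.log p + K₀ * W * (4 * W + (W ^ 2 + C₁)) + (4 * W + (δ * W ^ 4 + C)) := by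
        gcongr
    _ = d * Real.log p + δ * W ^ 4 + (K₀ * (4 * W ^ 2 + W ^ 3 + C₁ * W) + 4 * W + C * 1) := by
        ring
    _ ≤ d * Real.log p + δ * W ^ 4 +
          (K₀ * (4 * W ^ 3 + W ^ 3 + C₁ * W ^ 3) + 4 * W ^ 3 + C * W ^ 3) := by
        gcongr
    _ = _ := by ring

theorem weaklyTractable_of_tendsto (hnn : ∀ m, 0 ≤ lam m)
    (hord : ∀ m m' : ℕ, 1 ≤ m → m ≤ m' → lam m' ≤ lam m) (hl1 : 0 < lam 1)
    (hs : ∀ d, 0 < s d) {p : ℕ} (hp : 1 ≤ p) (hlamp : lam (p + 1) < lam 1)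
    {α c : ℝ} (hα : 0 ≤ α)
    (hinit : ∀ d : ℕ, 1 ≤ d → epsInit lam s d ≤ c * (d : ℝ) ^ α)
    (h : Tendsto (fun m : ℕ => lam m * Real.log m ^ (2 * (1 + α))) atTop (nhds 0))
    (hpd : ∀ δ > (0 : ℝ), ∃ T : ℝ, ∀ (d : ℕ) (ε : ℝ), 0 < ε → ε < epsInit lam s d →
      T ≤ ε⁻¹ + d → d * Real.log p ≤ δ * (ε⁻¹ + d)) : WeaklyTractable lam s := by
  set c' := max c 1 with hc'
  have hc1 : 1 ≤ c' := le_max_right _ _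
  have hc0 : 0 < c' := one_pos.trans_le hc1
  have hinit' : ∀ d : ℕ, 1 ≤ d → epsInit lam s d ≤ c' * (d : ℝ) ^ α := fun d hd =>
    (hinit d hd).trans (by gcongr; exact le_max_left _ _)
  have hroot : ∀ (d : ℕ) (ε : ℝ), 1 ≤ d → 0 < ε → ∃ W : ℝ, 1 ≤ W ∧ W ^ 4 = c' * (ε⁻¹ + d) := by
    intro d ε hd hε
    have h1 : 1 ≤ c' * (ε⁻¹ + d) := by
      have h2 : (1 : ℝ) ≤ d := by exact_mod_cast hd
      have := inv_pos.2 hε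
      exact one_le_mul_of_one_le_of_one_le hc1 (by linarith)
    refine ⟨(c' * (ε⁻¹ + d)) ^ ((4 : ℕ) : ℝ)⁻¹, Real.one_le_rpow h1 (by positivity), ?_⟩
    exact Real.rpow_inv_natCast_pow (by linarith) (by norm_num)
  rw [weaklyTractable_iff]
  refine ⟨fun d ε hd hε hεi => ?_, fun δ hδ => ?_⟩
  · obtain ⟨K, -, hK⟩ := finite_and_log_ncard_le hnn hord hl1 hs hp hlamp hα hc1 hinit' h one_pos
    obtain ⟨W, hW1, hW⟩ := hroot d ε hd hε
    exact (hK d ε W hd hε hεi hW1 hW).1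
  · set δ' := δ / (4 * c') with hδ'
    have hδ'0 : 0 < δ' := by positivity
    obtain ⟨K, hK0, hK⟩ :=
      finite_and_log_ncard_le hnn hord hl1 hs hp hlamp hα hc1 hinit' h hδ'0
    obtain ⟨T, hT⟩ := hpd (δ / 2) (half_pos hδ)
    refine ⟨max T ((K / δ') ^ 4), fun d ε hd hε hεi hTd => ?_⟩
    obtain ⟨W, hW1, hW⟩ := hroot d ε hd hε
    have hT0 : 0 < ε⁻¹ + (d : ℝ) := by have := inv_pos.2 hε; positivity
    have hKW : K ≤ δ' * W := by
      rw [← div_le_iff₀' hδ'0]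
      refine le_of_pow_le_pow_left₀ (n := 4) (by norm_num) (by linarith) ?_
      rw [hW]
      exact ((le_max_right _ _).trans hTd).trans (le_mul_of_one_le_left hT0.le hc1)
    calc _ ≤ _ := (hK d ε W hd hε hεi hW1 hW).2
      _ ≤ δ / 2 * (ε⁻¹ + d) + δ' * W ^ 4 + δ' * W * W ^ 3 := by
        have := hT d ε hε hεi ((le_max_left _ _).trans hTd)
        have := mul_le_mul_of_nonneg_right hKW (by positivity : 0 ≤ W ^ 3)
        linarith
      _ = δ / 2 * (ε⁻¹ + d) + 2 * δ' * W ^ 4 := by ring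
      _ = δ * (ε⁻¹ + d) := by rw [hW, hδ']; field_simp; ring

end Sufficiency

theorem exists_lt_of_tendsto_mul_log_sq {lam : ℕ → ℝ} (hl1 : 0 < lam 1)
    (h : Tendsto (fun m : ℕ => lam m * Real.log m ^ 2) atTop (nhds 0)) :
    ∃ p, 1 ≤ p ∧ lam (p + 1) < lam 1 := by
  have hlog := (Real.tendsto_log_atTop.comp tendsto_natCast_atTop_atTop).eventually_ge_atTop 1
  obtain ⟨m, ⟨hm1, hm2⟩, hm3⟩ :=
    (((h.eventually_lt_const hl1).and hlog).and (eventually_ge_atTop 2)).exists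
  refine ⟨m - 1, by omega, ?_⟩
  rw [Nat.sub_add_cancel (by omega)]
  by_contra! hcon
  have h1 : 1 ≤ Real.log m ^ 2 := one_le_pow₀ hm2
  exact hm1.not_ge (hcon.trans (le_mul_of_one_le_right (hl1.le.trans hcon) h1))

theorem natCast_mul_log_le_of_tendsto {lam s : ℕ → ℝ} {p : ℕ}
    (h : Tendsto (fun d : ℕ => (d : ℝ) * epsInit lam s d) atTop (nhds 0))
    (δ : ℝ) (hδ : 0 < δ) :
    ∃ T : ℝ, ∀ (d : ℕ) (ε : ℝ), 0 < ε → ε < epsInit lam s d →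
      T ≤ ε⁻¹ + d → d * Real.log p ≤ δ * (ε⁻¹ + d) := by
  have hlog : 0 ≤ Real.log p := Real.log_natCast_nonneg p
  obtain ⟨D, hD⟩ := eventually_atTop.1
    (h.eventually_lt_const (u := δ / (Real.log p + 1)) (by positivity))
  refine ⟨D * Real.log p / δ, fun d ε hε hεi hT => ?_⟩
  rcases le_total D d with hle | hle
  · have h1 : (d : ℝ) * ε ≤ δ / (Real.log p + 1) :=
      (mul_le_mul_of_nonneg_left hεi.le (Nat.cast_nonneg d)).trans (hD d hle).le
    rw [le_div_iff₀ (by positivity)] at h1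
    have h2 : (d : ℝ) * Real.log p ≤ δ * ε⁻¹ := by
      rw [← div_eq_mul_inv, le_div_iff₀ hε]
      have : 0 ≤ (d : ℝ) * ε := by positivity
      linarith
    have : 0 ≤ δ * (d : ℝ) := by positivity
    linarith
  · rw [div_le_iff₀' hδ] at hT
    exact le_trans (by gcongr) hT

/-- **Paper Theorem 3.11** (weak tractability and the curse for scaled tensor product
problems, absolute error criterion).
(a) If `ln ε_d^init ∉ o(d)` (i.e. `ε_d^init ≥ e^{cd}` for some `c > 0` and infinitely
many `d`) then the curse of dimensionality holds.
(b) If `ε_d^init ∈ Θ(d^α)` for some `α ≥ 0`: when `λ₁ = λ₂` the curse holds, while when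
`λ₁ > λ₂` the problem is weakly tractable iff `λ_n ∈ o(ln^{-2(1+α)} n)`.
(c) If `ε_d^init → 0` the curse never holds, and weak tractability holds iff either
(i) `λ₁ = λ₂`, `λ_n ∈ o(ln^{-2} n)` and `ε_d^init ∈ o(1/d)`, or
(ii) `λ₁ > λ₂` and `λ_n ∈ o(ln^{-2} n)`. -/
theorem stmt7 (lam : ℕ → ℝ) (s : ℕ → ℝ)
    (hnn : ∀ m, 0 ≤ lam m)
    (hord : ∀ m m' : ℕ, 1 ≤ m → m ≤ m' → lam m' ≤ lam m)
    (hlam2 : 0 < lam 2) (hs : ∀ d, 0 < s d) :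
    ((∃ c : ℝ, 0 < c ∧ ∀ D : ℕ, ∃ d : ℕ, D ≤ d ∧ Real.exp (c * d) ≤ epsInit lam s d) →
      SuffersCurse lam s) ∧
    (∀ α : ℝ, 0 ≤ α →
      (∃ c₁ > (0 : ℝ), ∃ c₂ > (0 : ℝ), ∀ d : ℕ, 1 ≤ d →
          c₁ * (d : ℝ) ^ α ≤ epsInit lam s d ∧ epsInit lam s d ≤ c₂ * (d : ℝ) ^ α) →
      ((lam 1 = lam 2 → SuffersCurse lam s) ∧
        (lam 2 < lam 1 →
          (WeaklyTractable lam s ↔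
            Tendsto (fun m : ℕ => lam m * Real.log m ^ (2 * (1 + α))) atTop (nhds 0))))) ∧
    (Tendsto (fun d : ℕ => epsInit lam s d) atTop (nhds 0) →
      ¬ SuffersCurse lam s ∧
      (WeaklyTractable lam s ↔
        ((lam 1 = lam 2 ∧
            Tendsto (fun m : ℕ => lam m * Real.log m ^ 2) atTop (nhds 0) ∧
            Tendsto (fun d : ℕ => (d : ℝ) * epsInit lam s d) atTop (nhds 0)) ∨
          (lam 2 < lam 1 ∧
            Tendsto (fun m : ℕ => lam m * Real.log m ^ 2) atTop (nhds 0))))) := by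
  have h12 : lam 2 ≤ lam 1 := hord 1 2 le_rfl one_le_two
  have hl1 : 0 < lam 1 := hlam2.trans_le h12
  have hlog1 : ∀ δ > (0 : ℝ), ∃ T : ℝ, ∀ (d : ℕ) (ε : ℝ), 0 < ε → ε < epsInit lam s d →
      T ≤ ε⁻¹ + d → d * Real.log (1 : ℕ) ≤ δ * (ε⁻¹ + d) := fun δ hδ =>
    ⟨0, fun d ε _ _ hT => by simpa using mul_nonneg hδ.le hT⟩
  refine ⟨fun ⟨c, hc, h⟩ => suffersCurse_of_exp_le hnn hord hlam2 hs hc h, ?_, ?_⟩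
  · rintro α hα ⟨c₁, hc₁, c₂, hc₂, hinit⟩
    refine ⟨fun heq => suffersCurse_of_eq hnn hord hl1 hs heq hc₁ fun d hd => ?_,
      fun hlt => ⟨fun hW => hW.tendsto_mul_log_rpow hnn hord hl1 hs hα hc₁ fun d hd =>
        (hinit d hd).1, fun h => weaklyTractable_of_tendsto hnn hord hl1 hs le_rfl hlt hα
        (fun d hd => (hinit d hd).2) h hlog1⟩⟩
    exact (le_mul_of_one_le_right hc₁.le
      (Real.one_le_rpow (by exact_mod_cast hd) hα)).trans (hinit d hd).1
  · intro hinit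
    refine ⟨not_suffersCurse_of_tendsto_zero hnn hord hs hinit, ?_⟩
    obtain ⟨c, hc⟩ := hinit.bddAbove_range
    have hc' : ∀ d : ℕ, 1 ≤ d → epsInit lam s d ≤ c * (d : ℝ) ^ (0 : ℝ) := fun d _ => by
      simpa using hc ⟨d, rfl⟩
    have hiff : Tendsto (fun m : ℕ => lam m * Real.log m ^ 2) atTop (nhds 0) →
        Tendsto (fun m : ℕ => lam m * Real.log m ^ (2 * (1 + (0 : ℝ)))) atTop (nhds 0) := by
      intro h
      simpa using h
    constructor
    · intro hW
      have hlog := hW.tendsto_mul_log_sq hnn hord hs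
      rcases h12.eq_or_lt with heq | hlt
      · exact Or.inl ⟨heq.symm, hlog, hW.tendsto_mul_epsInit hnn hord hl1 hs heq.symm⟩
      · exact Or.inr ⟨hlt, hlog⟩
    · rintro (⟨-, hlog, hd⟩ | ⟨hlt, hlog⟩)
      · obtain ⟨p, hp, hlamp⟩ := exists_lt_of_tendsto_mul_log_sq hl1 hlog
        exact weaklyTractable_of_tendsto hnn hord hl1 hs hp hlamp le_rfl hc' (hiff hlog)
          (natCast_mul_log_le_of_tendsto hd)
      · exact weaklyTractable_of_tendsto hnn hord hl1 hs le_rfl hlt le_rfl hc' (hiff hlog) hlog1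
end

section
/- Let λ = (λ_m)_{m≥1} be a non-increasing sequence of nonnegative reals with λ₂ > 0, and define the normalized information complexity of the (unscaled) tensor product problem by n_norm(ε,d) = #{ (j₁,…,j_d) ∈ (ℕ_{≥1})^d : (λ_{j₁}/λ₁)⋯(λ_{j_d}/λ₁) > ε² }. Then: (a) if λ₁ = λ₂ the problem suffers from the curse of dimensionality, i.e. there exist ε ∈ (0,1), C > 0, γ > 0 with n_norm(ε,d) ≥ C·(1+γ)^d for infinitely many d; (b) if λ₁ > λ₂, then the problem is weakly tractable if and only if λ_n·(ln n)² → 0 as n → ∞, and it is never polynomially tractable, i.e. there are no constants C, p > 0, q ≥ 0 with n_norm(ε,d) ≤ C·ε^{−p}·d^q for all d ≥ 1 and ε ∈ (0,1]. -/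
open scoped ENNReal
open Filter

/-- The set counted by the information complexity (normalized error criterion) of the
unscaled tensor product problem: `{ j ∈ (ℕ_{≥1})^d : ∏_k (λ_{j_k}/λ₁) > ε² }`. -/
def NormSet (lam : ℕ → ℝ) (ε : ℝ) (d : ℕ) : Set (Fin d → ℕ) :=
  {j | (∀ k, 1 ≤ j k) ∧ ε ^ 2 < ∏ k, lam (j k) / lam 1}

/-- Polynomial tractability with respect to the normalized error criterion. -/
def PTNorm (lam : ℕ → ℝ) : Prop :=
  ∃ C > (0 : ℝ), ∃ p > (0 : ℝ), ∃ q : ℝ, 0 ≤ q ∧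
    ∀ d : ℕ, 1 ≤ d → ∀ ε : ℝ, 0 < ε → ε ≤ 1 →
      ((NormSet lam ε d).encard : ℝ≥0∞) ≤ ENNReal.ofReal (C * ε ^ (-p) * (d : ℝ) ^ q)

/-- Weak tractability with respect to the normalized error criterion (the initial
error being `1`). -/
def WTNorm (lam : ℕ → ℝ) : Prop :=
  (∀ (d : ℕ) (ε : ℝ), 1 ≤ d → 0 < ε → ε < 1 → (NormSet lam ε d).Finite) ∧
  ∀ (εs : ℕ → ℝ) (ds : ℕ → ℕ),
    (∀ k, 0 < εs k ∧ εs k < 1) →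
    Tendsto (fun k => (εs k)⁻¹ + (ds k : ℝ)) atTop atTop →
    Tendsto (fun k =>
        Real.log (max ((NormSet lam (εs k) (ds k)).ncard : ℝ) 1) /
          ((εs k)⁻¹ + (ds k : ℝ))) atTop (nhds 0)

lemma card_le_encard_normSet {lam : ℕ → ℝ} (h1 : 0 < lam 1) {ε : ℝ} {d : ℕ}
    (𝒮 : Finset (Finset (Fin d)))
    (h𝒮 : ∀ s ∈ 𝒮, ε ^ 2 < (lam 2 / lam 1) ^ s.card) :
    (𝒮.card : ℕ∞) ≤ (NormSet lam ε d).encard := by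
  classical
  let f : Finset (Fin d) → Fin d → ℕ := fun s k => if k ∈ s then 2 else 1
  have hf : Function.Injective f := by
    intro s t hst
    ext k
    have := congrFun hst k
    by_cases hs : k ∈ s <;> by_cases ht : k ∈ t <;> simp_all [f]
  rw [← Set.encard_coe_eq_coe_finsetCard, ← hf.encard_image]
  refine Set.encard_le_encard ?_
  rintro _ ⟨s, hs, rfl⟩
  refine ⟨fun k => ?_, ?_⟩
  · by_cases hk : k ∈ s <;> simp [f, hk]
  · have : ∏ k, lam (f s k) / lam 1 = (lam 2 / lam 1) ^ s.card := by
      have : ∀ k, lam (f s k) / lam 1 = if k ∈ s then lam 2 / lam 1 else 1 := by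
        intro k
        by_cases hk : k ∈ s <;> simp [f, hk, h1.ne']
      simp_rw [this]
      rw [Finset.prod_ite_mem, Finset.univ_inter, Finset.prod_const]
    rw [this]
    exact h𝒮 s hs

lemma two_pow_le_encard_normSet {lam : ℕ → ℝ} (hlam2 : 0 < lam 2) (h12 : lam 1 = lam 2)
    {ε : ℝ} (hε0 : 0 < ε) (hε1 : ε < 1) (d : ℕ) :
    ((2 ^ d : ℕ) : ℕ∞) ≤ (NormSet lam ε d).encard := by
  have := card_le_encard_normSet (lam := lam) (h12 ▸ hlam2) (ε := ε) (d := d) Finset.univ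
    (fun s _ => by
      rw [h12, div_self hlam2.ne', one_pow]
      exact pow_lt_one₀ hε0.le hε1 two_ne_zero)
  simpa using this

lemma not_ptNorm {lam : ℕ → ℝ} (hlam2 : 0 < lam 2) (h12 : lam 2 < lam 1) :
    ¬ PTNorm lam := by
  rintro ⟨C, hC, p, hp, q, hq, h⟩
  have h1 : 0 < lam 1 := hlam2.trans h12
  set x := lam 2 / lam 1 with hx
  have hx0 : 0 < x := div_pos hlam2 h1
  have hx1 : x < 1 := (div_lt_one h1).2 h12
  obtain ⟨κ, hκ⟩ := exists_nat_ge (q + 1)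
  have hκ0 : κ ≠ 0 := by
    rintro rfl
    norm_num at hκ
    linarith
  set ε := x ^ κ with hε
  have hε0 : 0 < ε := pow_pos hx0 κ
  have hε1 : ε < 1 := pow_lt_one₀ hx0.le hx1 hκ0
  set A := C * ε ^ (-p) with hA
  have hA0 : 0 < A := by positivity
  have key : ∀ d : ℕ, 1 ≤ d → (d.choose κ : ℝ) ≤ A * (d : ℝ) ^ q := by
    intro d hd
    have hc := card_le_encard_normSet (lam := lam) h1 (ε := ε) (d := d)
      (Finset.powersetCard κ Finset.univ) (fun s hs => by
        rw [(Finset.mem_powersetCard.1 hs).2, ← hx, ← hε, sq]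
        exact mul_lt_of_lt_one_left hε0 hε1)
    rw [Finset.card_powersetCard, Finset.card_univ, Fintype.card_fin] at hc
    have hc' : ((d.choose κ : ℕ∞) : ℝ≥0∞) ≤ ENNReal.ofReal (A * (d : ℝ) ^ q) :=
      (ENat.toENNReal_mono hc).trans (h d hd ε hε0 hε1.le)
    rw [ENat.toENNReal_coe, ← ENNReal.ofReal_natCast] at hc'
    exact (ENNReal.ofReal_le_ofReal_iff (by positivity)).1 hc'
  obtain ⟨N, hN⟩ := exists_nat_gt (2 ^ κ * (κ.factorial * A))
  set d := N + 2 * κ with hd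
  have hd1 : 1 ≤ d := by omega
  have hd0 : (0 : ℝ) < d := by exact_mod_cast hd1
  have hpow : ((d : ℝ) / 2) ^ κ ≤ κ.factorial * (A * (d : ℝ) ^ q) := by
    calc ((d : ℝ) / 2) ^ κ ≤ ((d + 1 - κ : ℕ) : ℝ) ^ κ := by
          gcongr
          rw [div_le_iff₀ two_pos]
          exact_mod_cast (by omega : d ≤ (d + 1 - κ) * 2)
      _ ≤ κ.factorial * (d.choose κ : ℝ) := by
          have := Nat.pow_sub_le_descFactorial d κ
          rw [Nat.descFactorial_eq_factorial_mul_choose] at this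
          exact_mod_cast this
      _ ≤ _ := by gcongr; exact key d hd1
  have hge : (d : ℝ) * (d : ℝ) ^ q ≤ (d : ℝ) ^ κ := by
    rw [← Real.rpow_natCast (d : ℝ) κ, mul_comm, ← Real.rpow_add_one hd0.ne']
    exact Real.rpow_le_rpow_of_exponent_le (by exact_mod_cast hd1) hκ
  rw [div_pow, div_le_iff₀ (by positivity)] at hpow
  have hq0 : (0 : ℝ) < (d : ℝ) ^ q := Real.rpow_pos_of_pos hd0 q
  have : (d : ℝ) ≤ 2 ^ κ * (κ.factorial * A) := by
    refine le_of_mul_le_mul_right ?_ hq0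
    calc _ ≤ _ := hge
      _ ≤ _ := hpow
      _ = _ := by ring
  have hNd : (N : ℝ) ≤ d := by exact_mod_cast (by omega : N ≤ d)
  linarith

/-- Weak tractability, applied with `d = 1`, bounds the decay of the sequence. -/
lemma WTNorm.tendsto {lam : ℕ → ℝ} (hnn : ∀ m, 0 ≤ lam m)
    (hord : ∀ m m' : ℕ, 1 ≤ m → m ≤ m' → lam m' ≤ lam m) (h1 : 0 < lam 1)
    (h : WTNorm lam) :
    Tendsto (fun m : ℕ => lam m * Real.log m ^ 2) atTop (nhds 0) := by
  obtain ⟨hfin, hlim⟩ := h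
  have hlog : Tendsto (fun m : ℕ => Real.log m) atTop atTop :=
    Real.tendsto_log_atTop.comp tendsto_natCast_atTop_atTop
  have hlog0 : ∀ m : ℕ, 0 ≤ Real.log m := Real.log_natCast_nonneg
  refine (tendsto_order.2 ⟨fun c hc => .of_forall fun m => hc.trans_le
    (mul_nonneg (hnn m) (sq_nonneg _)), fun c hc => ?_⟩)
  set a := √(c / lam 1) with ha
  have ha0 : 0 < a := Real.sqrt_pos.2 (div_pos hc h1)
  have ha2 : a ^ 2 = c / lam 1 := Real.sq_sqrt (div_pos hc h1).le
  let ε : ℕ → ℝ := fun m => a / (Real.log m + 1 + a)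
  have hε : ∀ m, 0 < ε m ∧ ε m < 1 := fun m => by
    have := hlog0 m
    exact ⟨by positivity, (div_lt_one (by positivity)).2 (by linarith)⟩
  have hεinv : ∀ m, (ε m)⁻¹ = (Real.log m + 1) / a + 1 := fun m => by
    simp only [ε]
    field_simp
  have htend : Tendsto (fun m => (ε m)⁻¹ + ((1 : ℕ) : ℝ)) atTop atTop := by
    simp_rw [hεinv]
    exact tendsto_atTop_add_const_right _ _ (tendsto_atTop_add_const_right _ _
      ((tendsto_atTop_add_const_right _ _ hlog).atTop_div_const ha0))
  have hev := (hlim ε (fun _ => 1) hε htend).eventually_lt_const (half_pos ha0)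
  filter_upwards [hev, hlog.eventually_ge_atTop (1 + 2 * a), eventually_ge_atTop 1]
    with m hm hlm hm1
  by_contra! hcm
  have hlm0 : 0 < Real.log m := by linarith
  have hgap : ε m ^ 2 < lam m / lam 1 := by
    have h2 : c / Real.log m ^ 2 ≤ lam m := (div_le_iff₀ (by positivity)).2 hcm
    calc ε m ^ 2 < (a / Real.log m) ^ 2 := by
          simp only [ε]
          gcongr
          linarith
      _ = c / Real.log m ^ 2 / lam 1 := by rw [div_pow, ha2]; ring
      _ ≤ _ := by gcongr
  have hcard : m ≤ (NormSet lam (ε m) 1).ncard := by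
    let f : ℕ → Fin 1 → ℕ := fun i _ => i
    have hf : Function.Injective f := fun i i' hi => congrFun hi 0
    have hsub : f '' (Finset.Icc 1 m : Finset ℕ) ⊆ NormSet lam (ε m) 1 := by
      rintro _ ⟨i, hi, rfl⟩
      rw [Finset.mem_coe, Finset.mem_Icc] at hi
      refine ⟨fun _ => hi.1, ?_⟩
      simp only [f, Finset.univ_unique, Finset.prod_const, Finset.card_singleton, pow_one]
      exact hgap.trans_le (by gcongr; exact hord i m hi.1 hi.2)
    have := Set.ncard_le_ncard hsub (hfin 1 (ε m) le_rfl (hε m).1 (hε m).2)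
    rwa [Set.ncard_image_of_injective _ hf, Set.ncard_coe_finset, Nat.card_Icc,
      Nat.add_sub_cancel] at this
  have hle : Real.log m ≤ Real.log (max ((NormSet lam (ε m) 1).ncard : ℝ) 1) := by
    refine Real.log_le_log (by exact_mod_cast hm1) (le_max_of_le_left ?_)
    exact_mod_cast hcard
  rw [hεinv, div_lt_iff₀ (by push_cast; positivity)] at hm
  have : a / 2 * ((Real.log m + 1) / a + 1 + ((1 : ℕ) : ℝ)) = (Real.log m + 1) / 2 + a := by
    push_cast
    field_simp
    ring
  linarith

lemma Finset.sum_le_const_mul_prod {ι : Type*} {b : ℝ} (hb : 1 < b) (s : Finset ι) (y : ι → ℝ)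
    (hy : ∀ i ∈ s, b ≤ y i) : ∑ i ∈ s, y i ≤ b / (b - 1) * ∏ i ∈ s, y i := by
  classical
  have hb1 : 0 < b - 1 := by linarith
  induction s using Finset.induction_on with
  | empty => simp; positivity
  | insert i s hi ih =>
    have hyi := hy i (Finset.mem_insert_self i s)
    have ih := ih fun k hk => hy k (Finset.mem_insert_of_mem hk)
    have hP : 1 ≤ ∏ i ∈ s, y i := by
      rw [← Finset.prod_const_one (s := s)]
      exact Finset.prod_le_prod (fun _ _ => zero_le_one)
        fun k hk => hb.le.trans (hy k (Finset.mem_insert_of_mem hk))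
    rw [Finset.sum_insert hi, Finset.prod_insert hi]
    have h1 : y i ≤ b / (b - 1) * (y i - 1) := by
      rw [div_mul_eq_mul_div, le_div_iff₀ hb1]
      linarith
    have h2 : b / (b - 1) * (y i - 1) ≤ b / (b - 1) * (y i - 1) * ∏ i ∈ s, y i :=
      le_mul_of_one_le_right (mul_nonneg (by positivity) (by linarith)) hP
    linarith

lemma exists_mul_natCast_le_mul_pow_add {b : ℝ} (hb : 1 < b) {η : ℝ} (hη : 0 < η) (L : ℝ) :
    ∃ K : ℝ, ∀ s : ℕ, L * s ≤ η * b ^ s + K := by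
  have h : Tendsto (fun s : ℕ => L * ((s : ℝ) ^ 1 / b ^ s)) atTop (nhds (L * 0)) :=
    (tendsto_pow_const_div_const_pow_of_one_lt 1 hb).const_mul L
  rw [mul_zero] at h
  have hev := h.eventually_lt_const hη
  obtain ⟨N, hN⟩ := eventually_atTop.1 hev
  refine ⟨|L| * N, fun s => ?_⟩
  have hbs : 0 < b ^ s := by positivity
  rcases le_total N s with hs | hs
  · have := hN s hs
    rw [pow_one, ← mul_div_assoc, div_lt_iff₀ hbs] at this
    have : 0 ≤ |L| * N := by positivity
    linarith
  · have h1 : L * s ≤ |L| * N :=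
      mul_le_mul (le_abs_self L) (by exact_mod_cast hs) (by positivity) (abs_nonneg L)
    have : 0 ≤ η * b ^ s := by positivity
    linarith

lemma exists_log_le_mul_sqrt_add {lam : ℕ → ℝ} (h1 : 0 < lam 1)
    (h : Tendsto (fun m : ℕ => lam m * Real.log m ^ 2) atTop (nhds 0)) {δ : ℝ} (hδ : 0 < δ) :
    ∃ K : ℝ, ∀ m : ℕ, 1 ≤ m → 0 < lam m → Real.log m ≤ δ * √(lam 1 / lam m) + K := by
  obtain ⟨N, hN⟩ := eventually_atTop.1
    (h.eventually_lt_const (show 0 < δ ^ 2 * lam 1 by positivity))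
  refine ⟨Real.log N, fun m hm hlm => ?_⟩
  rcases le_total N m with hNm | hNm
  · have h2 : Real.log m ≤ √(δ ^ 2 * (lam 1 / lam m)) := by
      refine Real.le_sqrt_of_sq_le ?_
      rw [← mul_div_assoc, le_div_iff₀ hlm, mul_comm]
      exact (hN m hNm).le
    rw [Real.sqrt_mul (sq_nonneg δ), Real.sqrt_sq hδ.le] at h2
    have := Real.log_natCast_nonneg N
    linarith
  · have h2 : Real.log m ≤ Real.log N :=
      Real.log_le_log (by exact_mod_cast hm) (by exact_mod_cast hNm)
    have : 0 ≤ δ * √(lam 1 / lam m) := by positivity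
    linarith

/-- Along any index tuple counted by the information complexity, an additive cost on the
coordinates different from `1`, made of the logarithm of the index and a constant, is at most
an arbitrarily small multiple of `ε⁻¹` plus a constant. -/
lemma exists_sum_log_le {lam : ℕ → ℝ} (hnn : ∀ m, 0 ≤ lam m)
    (hord : ∀ m m' : ℕ, 1 ≤ m → m ≤ m' → lam m' ≤ lam m) (hlam2 : 0 < lam 2)
    (h12 : lam 2 < lam 1)
    (h : Tendsto (fun m : ℕ => lam m * Real.log m ^ 2) atTop (nhds 0))
    {η : ℝ} (hη : 0 < η) (T : ℝ) :
    ∃ K : ℝ, ∀ (d : ℕ) (ε : ℝ), 0 < ε → ∀ j ∈ NormSet lam ε d,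
      ∑ k with j k ≠ 1, (2 * Real.log (j k) + T) ≤ η * ε⁻¹ + K := by
  have h1 : 0 < lam 1 := hlam2.trans h12
  set b := √(lam 1 / lam 2) with hb
  have hb1 : 1 < b := by
    rw [hb, Real.lt_sqrt zero_le_one, one_pow]
    exact (one_lt_div hlam2).2 h12
  have hb2 : 0 < b - 1 := by linarith
  set B := b / (b - 1) with hB
  have hB0 : 0 < B := by positivity
  set δ := η / (4 * B) with hδ
  have hδ0 : 0 < δ := by positivity
  obtain ⟨K₁, hK₁⟩ := exists_log_le_mul_sqrt_add h1 h hδ0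
  obtain ⟨K₂, hK₂⟩ := exists_mul_natCast_le_mul_pow_add hb1 (half_pos hη) (2 * K₁ + T)
  refine ⟨K₂, fun d ε hε j hj => ?_⟩
  obtain ⟨hj1, hjε⟩ := hj
  have hpos : ∀ k, 0 < lam (j k) := fun k => by
    refine (hnn _).lt_of_ne' fun h0 => ?_
    rw [Finset.prod_eq_zero (Finset.mem_univ k) (by rw [h0, zero_div])] at hjε
    exact absurd hjε (not_lt.2 (sq_nonneg ε))
  set S : Finset (Fin d) := {k | j k ≠ 1} with hS
  set y : Fin d → ℝ := fun k => √(lam 1 / lam (j k)) with hy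
  have hyb : ∀ k ∈ S, b ≤ y k := fun k hk => by
    have hk1 : j k ≠ 1 := by simpa [hS] using hk
    refine Real.sqrt_le_sqrt (div_le_div_of_nonneg_left h1.le (hpos k) ?_)
    exact hord 2 (j k) one_le_two (by have := hj1 k; omega)
  have hprod : ∏ k ∈ S, y k ≤ ε⁻¹ := by
    have hall : ∏ k ∈ S, y k = ∏ k, y k := by
      refine Finset.prod_subset (Finset.subset_univ _) fun k _ hk => ?_
      have hk1 : j k = 1 := by simpa [hS] using hk
      simp [hy, hk1, h1.ne']
    rw [hall]
    refine (pow_le_pow_iff_left₀ (by positivity) (by positivity) two_ne_zero).1 ?_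
    have hsq : (∏ k, y k) ^ 2 = (∏ k, lam (j k) / lam 1)⁻¹ := by
      rw [← Finset.prod_pow, ← Finset.prod_inv_distrib]
      refine Finset.prod_congr rfl fun k _ => ?_
      rw [inv_div]
      exact Real.sq_sqrt (div_pos h1 (hpos k)).le
    rw [hsq, inv_pow]
    exact inv_anti₀ (by positivity) hjε.le
  have hpow : b ^ S.card ≤ ε⁻¹ := by
    refine le_trans ?_ hprod
    rw [← Finset.prod_const]
    exact Finset.prod_le_prod (fun _ _ => by positivity) hyb
  calc ∑ k ∈ S, (2 * Real.log (j k) + T)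
      ≤ ∑ k ∈ S, (2 * δ * y k + (2 * K₁ + T)) := by
        refine Finset.sum_le_sum fun k _ => ?_
        have := hK₁ (j k) (hj1 k) (hpos k)
        simp only [hy]
        linarith
    _ = 2 * δ * ∑ k ∈ S, y k + (2 * K₁ + T) * S.card := by
        rw [Finset.sum_add_distrib, ← Finset.mul_sum, Finset.sum_const, nsmul_eq_mul]
        ring
    _ ≤ 2 * δ * (B * ε⁻¹) + (η / 2 * ε⁻¹ + K₂) := by
        refine add_le_add ?_ ((hK₂ S.card).trans ?_)
        · have := Finset.sum_le_const_mul_prod hb1 S y hyb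
          gcongr
          exact this.trans (by gcongr)
        · gcongr
    _ = η * ε⁻¹ + K₂ := by
        rw [hδ]
        field_simp
        ring

lemma exists_normSet_bound {lam : ℕ → ℝ} (hnn : ∀ m, 0 ≤ lam m)
    (hord : ∀ m m' : ℕ, 1 ≤ m → m ≤ m' → lam m' ≤ lam m) (hlam2 : 0 < lam 2)
    (h12 : lam 2 < lam 1)
    (h : Tendsto (fun m : ℕ => lam m * Real.log m ^ 2) atTop (nhds 0))
    {η : ℝ} (hη : 0 < η) :
    ∃ K : ℝ, ∀ (d : ℕ) (ε : ℝ), 0 < ε → (NormSet lam ε d).Finite ∧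
      ((NormSet lam ε d).ncard : ℝ) ≤ Real.exp (η * (ε⁻¹ + d) + K) := by
  set t : ℝ := 1 + 2 / η with ht
  have ht1 : 1 < t := by
    have : 0 < 2 / η := by positivity
    linarith
  have ht0 : 0 < t := by linarith
  obtain ⟨K, hK⟩ := exists_sum_log_le hnn hord hlam2 h12 h hη (Real.log t)
  refine ⟨K, fun d ε hε => ?_⟩
  set R := η * ε⁻¹ + K with hR
  let w : ℕ → ℝ := fun n => if n = 1 then 1 else ((n : ℝ) ^ 2 * t)⁻¹
  have hw0 : ∀ n, 0 ≤ w n := fun n => by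
    by_cases hn : n = 1
    · simp [w, hn]
    · simp only [w, hn, if_false]
      positivity
  have hterm : ∀ j : Fin d → ℕ, (∀ k, 1 ≤ j k) → ∀ k, 0 ≤ 2 * Real.log (j k) + Real.log t :=
    fun j _ k => add_nonneg (mul_nonneg two_pos.le (Real.log_natCast_nonneg _))
      (Real.log_nonneg ht1.le)
  have hweight : ∀ j ∈ NormSet lam ε d, 1 ≤ Real.exp R * ∏ k, w (j k) := by
    intro j hj
    have hprod : ∏ k, w (j k) = Real.exp (-∑ k with j k ≠ 1, (2 * Real.log (j k) + Real.log t)) := by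
      rw [← Finset.sum_neg_distrib, Real.exp_sum, Finset.prod_filter]
      refine Finset.prod_congr rfl fun k _ => ?_
      by_cases hk : j k = 1
      · simp [w, hk]
      · have hk0 : (0 : ℝ) < j k := by exact_mod_cast hj.1 k
        simp only [w, hk, if_false, ne_eq, not_false_eq_true, if_true]
        rw [Real.exp_neg, Real.exp_add, Real.exp_log ht0, two_mul, Real.exp_add,
          Real.exp_log hk0, sq]
    rw [hprod, ← Real.exp_add]
    exact Real.one_le_exp (by have := hK d ε hε j hj; linarith)
  set M := ⌊Real.exp (max R 0)⌋₊ with hM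
  have hsub : NormSet lam ε d ⊆ (Fintype.piFinset fun _ : Fin d => Finset.Icc 1 M :) := by
    intro j hj
    rw [Finset.mem_coe, Fintype.mem_piFinset]
    intro k
    refine Finset.mem_Icc.2 ⟨hj.1 k, Nat.le_floor ?_⟩
    have hk0 : (0 : ℝ) < j k := by exact_mod_cast hj.1 k
    rw [← Real.log_le_iff_le_exp hk0]
    by_cases hk : j k = 1
    · simp [hk]
    · refine le_max_of_le_left (le_trans ?_ (hK d ε hε j hj))
      refine le_trans ?_ (Finset.single_le_sum (fun k _ => hterm j hj.1 k)
        (by simpa using hk : k ∈ ({k | j k ≠ 1} : Finset (Fin d))))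
      have := Real.log_natCast_nonneg (j k)
      have := Real.log_nonneg ht1.le
      linarith
  have hfin : (NormSet lam ε d).Finite := (Finset.finite_toSet _).subset hsub
  refine ⟨hfin, ?_⟩
  have hwsum : ∑ n ∈ Finset.Icc 1 M, w n ≤ 1 + η := by
    have hle : ∀ n ∈ Finset.Icc 1 M, w n ≤ (if n = 1 then 1 else 0) + t⁻¹ * ((n : ℝ) ^ 2)⁻¹ := by
      intro n _
      by_cases hn : n = 1
      · simp [w, hn, ht0.le]
      · simp [w, hn]
    have hsq : ∑ n ∈ Finset.Icc 1 M, ((n : ℝ) ^ 2)⁻¹ ≤ 2 := by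
      have := sum_Ioo_inv_sq_le (α := ℝ) 0 (M + 1)
      have hI : Finset.Ioo 0 (M + 1) = Finset.Icc 1 M := by
        ext n
        simp only [Finset.mem_Ioo, Finset.mem_Icc]
        omega
      simpa [hI] using this
    calc ∑ n ∈ Finset.Icc 1 M, w n
        ≤ ∑ n ∈ Finset.Icc 1 M, ((if n = 1 then 1 else 0) + t⁻¹ * ((n : ℝ) ^ 2)⁻¹) :=
          Finset.sum_le_sum hle
      _ ≤ 1 + t⁻¹ * 2 := by
          rw [Finset.sum_add_distrib, ← Finset.mul_sum]
          refine add_le_add ?_ (by gcongr)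
          rw [Finset.sum_ite_eq']
          split_ifs <;> norm_num
      _ ≤ 1 + η := by
          have : t⁻¹ ≤ (2 / η)⁻¹ := inv_anti₀ (by positivity) (by linarith)
          rw [inv_div] at this
          linarith
  have hcard : ((NormSet lam ε d).ncard : ℝ) ≤ ∑ j ∈ hfin.toFinset, Real.exp R * ∏ k, w (j k) := by
    rw [Set.ncard_eq_toFinset_card _ hfin, ← nsmul_one]
    exact Finset.card_nsmul_le_sum _ _ _ fun j hj => hweight j (hfin.mem_toFinset.1 hj)
  calc ((NormSet lam ε d).ncard : ℝ)
      ≤ ∑ j ∈ Fintype.piFinset fun _ : Fin d => Finset.Icc 1 M, Real.exp R * ∏ k, w (j k) := by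
        refine hcard.trans (Finset.sum_le_sum_of_subset_of_nonneg ?_ fun j _ _ => ?_)
        · intro j hj
          exact hsub (hfin.mem_toFinset.1 hj)
        · exact mul_nonneg (Real.exp_pos R).le (Finset.prod_nonneg fun k _ => hw0 _)
    _ = Real.exp R * (∑ n ∈ Finset.Icc 1 M, w n) ^ d := by
        rw [← Finset.mul_sum, ← Finset.prod_univ_sum]
        simp
    _ ≤ Real.exp R * (Real.exp η) ^ d := by
        have := Finset.sum_nonneg fun n (_ : n ∈ Finset.Icc 1 M) => hw0 n
        gcongr
        linarith [Real.add_one_le_exp η]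
    _ = Real.exp (η * (ε⁻¹ + d) + K) := by
        rw [← Real.exp_nat_mul, ← Real.exp_add, hR]
        ring_nf

lemma wtNorm_of_tendsto {lam : ℕ → ℝ} (hnn : ∀ m, 0 ≤ lam m)
    (hord : ∀ m m' : ℕ, 1 ≤ m → m ≤ m' → lam m' ≤ lam m) (hlam2 : 0 < lam 2)
    (h12 : lam 2 < lam 1)
    (h : Tendsto (fun m : ℕ => lam m * Real.log m ^ 2) atTop (nhds 0)) : WTNorm lam := by
  refine ⟨fun d ε _ hε _ => ?_, fun ε d hε htend => ?_⟩
  · obtain ⟨K, hK⟩ := exists_normSet_bound hnn hord hlam2 h12 h one_pos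
    exact (hK d ε hε).1
  have hden : ∀ k, 0 < (ε k)⁻¹ + (d k : ℝ) := fun k =>
    add_pos_of_pos_of_nonneg (inv_pos.2 (hε k).1) (Nat.cast_nonneg _)
  refine tendsto_order.2 ⟨fun c hc => .of_forall fun k => hc.trans_le
    (div_nonneg (Real.log_nonneg (le_max_right _ _)) (hden k).le), fun c hc => ?_⟩
  obtain ⟨K, hK⟩ := exists_normSet_bound hnn hord hlam2 h12 h (half_pos hc)
  filter_upwards [htend.eventually_gt_atTop (2 * |K| / c)] with k hk
  rw [div_lt_iff₀ hc] at hk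
  rw [div_lt_iff₀ (hden k)]
  have hle : Real.log (max ((NormSet lam (ε k) (d k)).ncard : ℝ) 1) ≤
      c / 2 * ((ε k)⁻¹ + d k) + |K| := by
    rw [Real.log_le_iff_le_exp (by positivity)]
    refine max_le (((hK (d k) (ε k) (hε k).1).2).trans ?_) (Real.one_le_exp ?_)
    · gcongr
      exact le_abs_self K
    · have := hden k
      positivity
  linarith

/-- **Paper Theorem 2.9** (unweighted tensor product problems, normalized error
criterion): (a) if `λ₁ = λ₂` the problem suffers from the curse of dimensionality;
(b) if `λ₁ > λ₂` it is weakly tractable iff `λ_n ∈ o(ln^{-2} n)`, and it is never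
polynomially tractable. -/
theorem stmt9 (lam : ℕ → ℝ)
    (hnn : ∀ m, 0 ≤ lam m)
    (hord : ∀ m m' : ℕ, 1 ≤ m → m ≤ m' → lam m' ≤ lam m)
    (hlam2 : 0 < lam 2) :
    (lam 1 = lam 2 →
      ∃ ε : ℝ, 0 < ε ∧ ε < 1 ∧ ∃ C > (0 : ℝ), ∃ γ > (0 : ℝ), ∀ D : ℕ, ∃ d : ℕ,
        D ≤ d ∧ 1 ≤ d ∧
        ENNReal.ofReal (C * (1 + γ) ^ d) ≤ ((NormSet lam ε d).encard : ℝ≥0∞)) ∧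
    (lam 2 < lam 1 →
      (WTNorm lam ↔
        Tendsto (fun m : ℕ => lam m * Real.log m ^ 2) atTop (nhds 0)) ∧
      ¬ PTNorm lam) := by
  refine ⟨fun h12 => ⟨1 / 2, by norm_num, by norm_num, 1, one_pos, 1, one_pos, fun D =>
    ⟨D + 1, by omega, by omega, ?_⟩⟩, fun h12 =>
    ⟨⟨fun h => h.tendsto hnn hord (hlam2.trans h12),
      wtNorm_of_tendsto hnn hord hlam2 h12⟩, not_ptNorm hlam2 h12⟩⟩
  have hle := ENat.toENNReal_mono (two_pow_le_encard_normSet hlam2 h12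
    (ε := 1 / 2) (by norm_num) (by norm_num) (D + 1))
  have heq : (1 * (1 + 1) ^ (D + 1) : ℝ) = ((2 ^ (D + 1) : ℕ) : ℝ) := by
    push_cast
    norm_num
  rwa [heq, ENNReal.ofReal_natCast, ← ENat.toENNReal_coe]
end
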